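/- arXiv:2605.04912 — 14 statements merged into one kernel-verified Lean document; each statement's English description precedes it below -/
import Mathlib

section
/- Let (Ω, ℱ) be a measurable space and 𝒫 a σ-convex family of probability measures on ℱ. Then the following are equivalent: (1) 𝒫 is dominated by a σ-finite measure, i.e. there exists a σ-finite measure μ on ℱ with P ≪ μ for every P ∈ 𝒫; (2) there exists an at most countable set 𝒬 of pairwise mutually singular probability measures on ℱ such that 𝒬 ⋘ 𝒫 ⋘ sconv(𝒬). -/
open MeasureTheory Set
open scoped ENNReal

variable {Ω : Type*}

/-- `Q ⋘ P`: every element of `Q` is absolutely continuous w.r.t. some element of `P`. -/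
def Lll [MeasurableSpace Ω] (Q P : Set (Measure Ω)) : Prop :=
  ∀ q ∈ Q, ∃ p ∈ P, q ≪ p

/-- The σ-convex hull of a family of measures: all countable convex combinations
`∑_k λ_k Q_k` with `λ_k ≥ 0`, `∑_k λ_k = 1`, `Q_k ∈ Q`. -/
def sconv [MeasurableSpace Ω] (Q : Set (Measure Ω)) : Set (Measure Ω) :=
  {μ | ∃ (f : ℕ → Measure Ω) (l : ℕ → ℝ≥0∞), (∀ k, f k ∈ Q) ∧ (∑' k, l k) = 1 ∧
    μ = Measure.sum fun k => l k • f k}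

theorem exists_mem_forall_absolutelyContinuous_of_sconv_subset [MeasurableSpace Ω]
    {P : Set (Measure Ω)} (hconv : sconv P ⊆ P) (f : ℕ → Measure Ω) (hf : ∀ n, f n ∈ P) :
    ∃ p ∈ P, ∀ n, f n ≪ p := by
  have hl : ∑' k : ℕ, (2⁻¹ : ℝ≥0∞) ^ (k + 1) = 1 := by
    rw [ENNReal.tsum_geometric_add_one, ENNReal.one_sub_inv_two, inv_inv]
    exact ENNReal.inv_mul_cancel (by simp) (by simp)
  refine ⟨_, hconv ⟨f, fun k => 2⁻¹ ^ (k + 1), hf, hl, rfl⟩, fun n s hs => ?_⟩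
  have h := Measure.le_sum (fun k => (2⁻¹ : ℝ≥0∞) ^ (k + 1) • f k) n s
  simpa [hs] using h

/-- The set where the Radon–Nikodym derivative of `p` with respect to `μ` does not vanish. -/
def rnSupport [MeasurableSpace Ω] (μ p : Measure Ω) : Set Ω :=
  {x | p.rnDeriv μ x ≠ 0}

theorem measurableSet_rnSupport [MeasurableSpace Ω] (μ p : Measure Ω) :
    MeasurableSet (rnSupport μ p) :=
  Measure.measurable_rnDeriv p μ (measurableSet_singleton 0).compl

theorem measure_eq_zero_iff_inter_rnSupport [MeasurableSpace Ω] {μ p : Measure Ω}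
    [IsFiniteMeasure μ] [IsFiniteMeasure p] (h : p ≪ μ) (s : Set Ω) :
    p s = 0 ↔ μ (rnSupport μ p ∩ s) = 0 := by
  conv_lhs => rw [← Measure.withDensity_rnDeriv_eq p μ h]
  exact withDensity_apply_eq_zero (Measure.measurable_rnDeriv p μ)

theorem absolutelyContinuous_iff_rnSupport_diff [MeasurableSpace Ω] {μ p q : Measure Ω}
    [IsFiniteMeasure μ] [IsFiniteMeasure p] [IsFiniteMeasure q] (hp : p ≪ μ) (hq : q ≪ μ) :
    p ≪ q ↔ μ (rnSupport μ p \ rnSupport μ q) = 0 := by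
  refine ⟨fun h => ?_, fun h s hs => ?_⟩
  · rw [sdiff_eq, ← measure_eq_zero_iff_inter_rnSupport hp]
    apply h
    rw [measure_eq_zero_iff_inter_rnSupport hq]
    simp
  · rw [measure_eq_zero_iff_inter_rnSupport hq] at hs
    rw [measure_eq_zero_iff_inter_rnSupport hp]
    refine measure_mono_null (fun x hx => ?_) (measure_union_null h hs)
    by_cases hxq : x ∈ rnSupport μ q
    · exact Or.inr ⟨hxq, hx.2⟩
    · exact Or.inl ⟨hx.1, hxq⟩

/-- **Halmos–Savage**: a nonempty σ-convex family dominated by a finite measure contains an element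
dominating the whole family. -/
theorem exists_mem_dominating_of_sconv_subset [MeasurableSpace Ω] {P : Set (Measure Ω)}
    (hP : ∀ p ∈ P, IsFiniteMeasure p) (hconv : sconv P ⊆ P) (hne : P.Nonempty)
    (μ : Measure Ω) [IsFiniteMeasure μ] (hμ : ∀ p ∈ P, p ≪ μ) :
    ∃ p ∈ P, ∀ q ∈ P, q ≪ p := by
  have hmono : ∀ p ∈ P, ∀ q ∈ P, p ≪ q → μ (rnSupport μ p) ≤ μ (rnSupport μ q) := by
    intro p hp q hq hpq
    have := hP p hp
    have := hP q hq
    exact measure_mono_ae (ae_le_set.2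
      ((absolutelyContinuous_iff_rnSupport_diff (hμ p hp) (hμ q hq)).1 hpq))
  obtain ⟨u, -, hu, hmem⟩ := exists_seq_tendsto_sSup
    (hne.image fun p => μ (rnSupport μ p)) (OrderTop.bddAbove _)
  choose f hf hfu using hmem
  obtain ⟨p, hp, hfp⟩ := exists_mem_forall_absolutelyContinuous_of_sconv_subset hconv f hf
  have hmax : ∀ q ∈ P, μ (rnSupport μ q) ≤ μ (rnSupport μ p) := fun q hq =>
    (le_sSup (mem_image_of_mem _ hq)).trans <| le_of_tendsto' hu fun n => by
      rw [← hfu n]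
      exact hmono _ (hf n) _ hp (hfp n)
  refine ⟨p, hp, fun q hq => ?_⟩
  obtain ⟨r, hr, hrs⟩ := exists_mem_forall_absolutelyContinuous_of_sconv_subset hconv
    (fun n => if n = 0 then p else q) (fun n => by split_ifs <;> assumption)
  have hpr : p ≪ r := by simpa using hrs 0
  have hqr : q ≪ r := by simpa using hrs 1
  have := hP p hp
  have := hP r hr
  refine hqr.trans ((absolutelyContinuous_iff_rnSupport_diff (hμ r hr) (hμ p hp)).2 ?_)
  have hsub : rnSupport μ p ≤ᵐ[μ] rnSupport μ r :=
    ae_le_set.2 ((absolutelyContinuous_iff_rnSupport_diff (hμ p hp) (hμ r hr)).1 hpr)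
  exact ae_le_set.1 (ae_eq_of_ae_subset_of_measure_ge hsub (hmax r hr)
    (measurableSet_rnSupport μ p).nullMeasurableSet (measure_ne_top μ _)).symm.le

theorem absolutelyContinuous_of_mem_sconv [MeasurableSpace Ω] {Q : Set (Measure Ω)}
    {μ ν : Measure Ω} (hQ : ∀ q ∈ Q, q ≪ μ) (hν : ν ∈ sconv Q) : ν ≪ μ := by
  obtain ⟨f, l, hf, -, rfl⟩ := hν
  exact Measure.absolutelyContinuous_sum_left fun k => (hQ _ (hf k)).smul_left (l k)

theorem subset_sconv [MeasurableSpace Ω] (Q : Set (Measure Ω)) : Q ⊆ sconv Q := by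
  intro q hq
  refine ⟨fun _ => q, fun k => if k = 0 then 1 else 0, fun _ => hq, by simp, ?_⟩
  ext s hs
  rw [Measure.sum_apply _ hs, tsum_eq_single 0 fun k hk => by simp [hk]]
  simp

/-- For a σ-convex family `P` of probability measures, `P` is dominated by a
σ-finite measure iff there is an at most countable set `Q` of pairwise mutually singular
probability measures with `Q ⋘ P ⋘ sconv Q`. -/
theorem stmt0 [MeasurableSpace Ω] (P : Set (Measure Ω))
    (hP : ∀ p ∈ P, IsProbabilityMeasure p) (hconv : sconv P = P) :
    (∃ μ : Measure Ω, SigmaFinite μ ∧ ∀ p ∈ P, p ≪ μ) ↔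
      ∃ Q : Set (Measure Ω), Q.Countable ∧ (∀ q ∈ Q, IsProbabilityMeasure q) ∧
        Q.Pairwise (· ⟂ₘ ·) ∧ Lll Q P ∧ Lll P (sconv Q) := by
  constructor
  · rintro ⟨μ, _, hμ⟩
    rcases P.eq_empty_or_nonempty with rfl | hne
    · exact ⟨∅, countable_empty, by simp, by simp, by simp [Lll], by simp [Lll]⟩
    · obtain ⟨p, hp, hdom⟩ := exists_mem_dominating_of_sconv_subset
        (fun p hp => have := hP p hp; inferInstance) hconv.le hne μ.toFinite
        (fun p hp => (hμ p hp).trans (absolutelyContinuous_toFinite μ))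
      refine ⟨{p}, countable_singleton p, ?_, pairwise_singleton _ _, ?_, ?_⟩
      · rintro q rfl
        exact hP _ hp
      · rintro q rfl
        exact ⟨_, hp, .rfl⟩
      · exact fun q hq => ⟨p, subset_sconv _ rfl, hdom q hq⟩
  · rintro ⟨Q, hQc, hQ, -, -, hPQ⟩
    have := hQc.to_subtype
    have (q : Q) : IsProbabilityMeasure (q : Measure Ω) := hQ q q.2
    refine ⟨(Measure.sum fun q : Q => (q : Measure Ω)).toFinite, inferInstance, fun p hp => ?_⟩
    obtain ⟨ν, hν, hpν⟩ := hPQ p hp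
    refine (hpν.trans (absolutelyContinuous_of_mem_sconv (fun q hq => ?_) hν)).trans
      (absolutelyContinuous_toFinite _)
    exact (Measure.le_sum (fun q : Q => (q : Measure Ω)) ⟨q, hq⟩).absolutelyContinuous
end

section
/- Let 𝒫 be a σ-convex, pre-Hahn-localizable family of probability measures on (Ω, ℱ) with localization 𝒬 and supports {S_Q}. Then 𝒫 is Hahn-localizable if and only if the following gluing property holds: for every family {g_Q}_{Q∈𝒬} of non-negative measurable functions g_Q : Ω → ℝ for which there exists M > 0 with g_Q ≤ M 𝒫-q.s. for all Q ∈ 𝒬 and with g_Q = 0 𝒫-q.s. on Ω \ S_Q, there exists a measurable function g : Ω → ℝ that is 𝒫-q.s. bounded and satisfies g·1_{S_Q} = g_Q·1_{S_Q} 𝒫-q.s. for every Q ∈ 𝒬. -/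
open MeasureTheory Set
open scoped ENNReal

variable {Ω : Type*}

/-- `P` is pre-Hahn-localizable with localization `Q` and supports `S`. -/
structure IsPreHahnLoc [MeasurableSpace Ω] (P Q : Set (Measure Ω))
    (S : Measure Ω → Set Ω) : Prop where
  probP : ∀ p ∈ P, IsProbabilityMeasure p
  probQ : ∀ q ∈ Q, IsProbabilityMeasure q
  measS : ∀ q ∈ Q, MeasurableSet (S q)
  self : ∀ q ∈ Q, q (S q) = 1
  other : ∀ q ∈ Q, ∀ r ∈ Q, q ≠ r → q (S r) = 0
  qp : Lll Q P
  ps : Lll P (sconv Q)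

/-- `T` is an essential supremum (in the sense of Hahn-localizability) of the family `E`. -/
def HasEssSup [MeasurableSpace Ω] (Q : Set (Measure Ω)) (E : Measure Ω → Set Ω)
    (T : Set Ω) : Prop :=
  MeasurableSet T ∧ (∀ q ∈ Q, q (E q \ T) = 0) ∧
    ∀ F : Set Ω, MeasurableSet F → (∀ q ∈ Q, q (E q \ F) = 0) → ∀ q ∈ Q, q (T \ F) = 0

/-- A set null for every measure in `Q` is null for every measure dominated by `sconv Q`. -/
theorem IsPreHahnLoc.null_of_forall [MeasurableSpace Ω] {P Q : Set (Measure Ω)}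
    {S : Measure Ω → Set Ω} (h : IsPreHahnLoc P Q S) {A : Set Ω}
    (hA : ∀ q ∈ Q, q A = 0) : ∀ p ∈ P, p A = 0 := by
  intro p hp
  obtain ⟨μ, ⟨f, l, hf, -, rfl⟩, hac⟩ := h.ps p hp
  refine hac ?_
  rw [Measure.sum_apply_eq_zero]
  intro k
  simp [hA _ (hf k)]

/-- A set null for every measure in `P` is null for every measure in `Q`. -/
theorem IsPreHahnLoc.null_localization [MeasurableSpace Ω] {P Q : Set (Measure Ω)}
    {S : Measure Ω → Set Ω} (h : IsPreHahnLoc P Q S) {A : Set Ω}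
    (hA : ∀ p ∈ P, p A = 0) {q : Measure Ω} (hq : q ∈ Q) : q A = 0 := by
  obtain ⟨p, hp, hac⟩ := h.qp q hq
  exact hac (hA p hp)

/-- A subset of the support `S q` is `P`-polar as soon as it is `q`-null. -/
theorem IsPreHahnLoc.null_of_subset_support [MeasurableSpace Ω] {P Q : Set (Measure Ω)}
    {S : Measure Ω → Set Ω} (h : IsPreHahnLoc P Q S) {q : Measure Ω} (hq : q ∈ Q) {A : Set Ω}
    (hAS : A ⊆ S q) (hA : q A = 0) : ∀ p ∈ P, p A = 0 := by
  refine h.null_of_forall fun r hr => ?_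
  by_cases hrq : r = q
  · exact hrq ▸ hA
  · exact measure_mono_null hAS (h.other r hr q hq hrq)

/-- Each `q ∈ Q` is concentrated on its support. -/
theorem IsPreHahnLoc.ae_mem_support [MeasurableSpace Ω] {P Q : Set (Measure Ω)}
    {S : Measure Ω → Set Ω} (h : IsPreHahnLoc P Q S) {q : Measure Ω} (hq : q ∈ Q) :
    ∀ᵐ ω ∂q, ω ∈ S q := by
  have := h.probQ q hq
  exact (mem_ae_iff_prob_eq_one (h.measS q hq)).2 (h.self q hq)

/-- An essential supremum of sets `E q ⊆ S q` agrees with `E q` almost surely under `q`. -/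
theorem HasEssSup.ae_mem_iff [MeasurableSpace Ω] {P Q : Set (Measure Ω)}
    {S : Measure Ω → Set Ω} (h : IsPreHahnLoc P Q S) {E : Measure Ω → Set Ω} {T : Set Ω}
    (hE : ∀ q ∈ Q, MeasurableSet (E q)) (hT : HasEssSup Q E T) {q : Measure Ω} (hq : q ∈ Q) :
    ∀ᵐ ω ∂q, ω ∈ T ↔ ω ∈ E q := by
  obtain ⟨hTm, hET, hmin⟩ := hT
  have hF := hmin (T \ (S q \ E q)) (hTm.diff ((h.measS q hq).diff (hE q hq))) (by
    intro r hr
    by_cases hrq : r = q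
    · subst hrq
      refine measure_mono_null (fun ω hω => ?_) (hET r hr)
      simp only [mem_sdiff] at hω ⊢
      tauto
    · refine measure_mono_null (fun ω hω => ?_)
        (measure_union_null (hET r hr) (h.other r hr q hq hrq))
      simp only [mem_sdiff, mem_union] at hω ⊢
      tauto) q hq
  filter_upwards [measure_eq_zero_iff_ae_notMem.1 (hET q hq),
    measure_eq_zero_iff_ae_notMem.1 hF, h.ae_mem_support hq] with ω h₁ h₂ h₃
  simp only [mem_sdiff] at h₁ h₂
  tauto

/-- A non-negative real is the supremum of the rationals below it. -/
theorem iSup_rat_lt_eq_ofReal (x : ℝ) :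
    ⨆ r : ℚ, {y : ℝ | (r : ℝ) < y}.indicator (fun _ => ENNReal.ofReal r) x
      = ENNReal.ofReal x := by
  refine le_antisymm (iSup_le fun r => ?_) (le_of_forall_lt fun c hc => ?_)
  · refine indicator_apply_le' (fun hr => ENNReal.ofReal_le_ofReal (le_of_lt hr)) fun _ => zero_le
  · obtain ⟨r, -, hcr, hrx⟩ := ENNReal.lt_iff_exists_rat_btwn.1 hc
    have hr : (r : ℝ) < x := (ENNReal.ofReal_lt_ofReal_iff').1 hrx |>.1
    refine lt_of_lt_of_le hcr (le_iSup_of_le r ?_)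
    rw [indicator_of_mem (by exact hr)]
    rfl

/-- For a σ-convex pre-Hahn-localizable family `P` with localization `Q`
and supports `S`, Hahn-localizability is equivalent to the gluing property for 𝒫-q.s. uniformly
bounded non-negative measurable functions supported on the sets `S q`. -/
theorem stmt1 [MeasurableSpace Ω] (P Q : Set (Measure Ω)) (S : Measure Ω → Set Ω)
    (hconv : sconv P = P) (hpre : IsPreHahnLoc P Q S) :
    (∀ E : Measure Ω → Set Ω, (∀ q ∈ Q, MeasurableSet (E q) ∧ E q ⊆ S q) →
        ∃ T : Set Ω, HasEssSup Q E T) ↔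
      (∀ g : Measure Ω → Ω → ℝ,
        (∀ q ∈ Q, Measurable (g q)) →
        (∀ q ∈ Q, ∀ ω, 0 ≤ g q ω) →
        (∃ M : ℝ, 0 < M ∧ ∀ q ∈ Q, ∀ p ∈ P, p {ω | M < g q ω} = 0) →
        (∀ q ∈ Q, ∀ p ∈ P, p {ω | ω ∉ S q ∧ g q ω ≠ 0} = 0) →
        ∃ g₀ : Ω → ℝ, Measurable g₀ ∧ (∃ M : ℝ, ∀ p ∈ P, p {ω | M < |g₀ ω|} = 0) ∧
          ∀ q ∈ Q, ∀ p ∈ P, p {ω | ω ∈ S q ∧ g₀ ω ≠ g q ω} = 0) := by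
  constructor
  · rintro hloc g hgm hg0 ⟨M, hM, hgM⟩ -
    have hEm : ∀ r : ℚ, ∀ q ∈ Q, MeasurableSet (S q ∩ {ω | (r : ℝ) < g q ω}) := fun r q hq =>
      (hpre.measS q hq).inter (measurableSet_lt measurable_const (hgm q hq))
    choose T hT using fun r : ℚ => hloc (fun q => S q ∩ {ω | (r : ℝ) < g q ω})
      fun q hq => ⟨hEm r q hq, inter_subset_left⟩
    let G : Ω → ℝ≥0∞ := fun ω =>
      min (⨆ r : ℚ, (T r).indicator (fun _ => ENNReal.ofReal r) ω) (ENNReal.ofReal M)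
    have hG : Measurable G :=
      (Measurable.iSup fun r => measurable_const.indicator (hT r).1).min measurable_const
    refine ⟨fun ω => (G ω).toReal, hG.ennreal_toReal, ⟨M, fun p _ => ?_⟩, fun q hq => ?_⟩
    · convert measure_empty (μ := p)
      refine eq_empty_of_forall_notMem fun ω hω => not_le.2 (mem_ofPred.1 hω) ?_
      rw [abs_of_nonneg ENNReal.toReal_nonneg]
      exact ENNReal.toReal_le_of_le_ofReal hM.le (min_le_right _ _)
    · refine hpre.null_of_subset_support hq (fun ω hω => hω.1) ?_
      rw [measure_eq_zero_iff_ae_notMem]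
      have hTq : ∀ᵐ ω ∂q, ∀ r : ℚ, ω ∈ T r ↔ ω ∈ S q ∩ {ω | (r : ℝ) < g q ω} :=
        ae_all_iff.2 fun r => (hT r).ae_mem_iff hpre (hEm r) hq
      filter_upwards [hTq, measure_eq_zero_iff_ae_notMem.1 (hpre.null_localization (hgM q hq) hq)]
        with ω hω hωM
      rintro ⟨hS, hne⟩
      refine hne ?_
      have hsup : ⨆ r : ℚ, (T r).indicator (fun _ => ENNReal.ofReal r) ω
          = ENNReal.ofReal (g q ω) := by
        rw [← iSup_rat_lt_eq_ofReal]
        refine iSup_congr fun r => ?_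
        by_cases hr : (r : ℝ) < g q ω
        · rw [indicator_of_mem ((hω r).2 ⟨hS, hr⟩), indicator_of_mem (by exact hr)]
        · rw [indicator_of_notMem fun h => hr ((hω r).1 h).2, indicator_of_notMem (by exact hr)]
      simp only [G, hsup]
      rw [min_eq_left (ENNReal.ofReal_le_ofReal (not_lt.1 hωM)), ENNReal.toReal_ofReal (hg0 q hq ω)]
  · intro hglue E hE
    obtain ⟨g₀, hg₀, -, hg⟩ := hglue (fun q => (E q).indicator 1)
      (fun q hq => measurable_one.indicator (hE q hq).1)
      (fun q _ ω => indicator_nonneg (fun _ _ => zero_le_one) ω)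
      ⟨1, one_pos, fun q _ p _ => by
        convert measure_empty (μ := p)
        refine eq_empty_of_forall_notMem fun ω hω => not_le.2 (mem_ofPred.1 hω) ?_
        exact indicator_apply_le' (fun _ => le_rfl) fun _ => zero_le_one⟩
      (fun q hq p _ => by
        convert measure_empty (μ := p)
        refine eq_empty_of_forall_notMem fun ω hω => hω.2 ?_
        exact indicator_of_notMem (fun h => hω.1 ((hE q hq).2 h)) _)
    have hT : ∀ q ∈ Q, ∀ᵐ ω ∂q, g₀ ω = 1 ↔ ω ∈ E q := by
      intro q hq
      filter_upwards [hpre.ae_mem_support hq,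
        measure_eq_zero_iff_ae_notMem.1 (hpre.null_localization (hg q hq) hq)] with ω hS hω
      have hgω : g₀ ω = (E q).indicator 1 ω := by
        by_contra hne
        exact hω ⟨hS, hne⟩
      rw [hgω]
      by_cases h : ω ∈ E q <;> simp [h]
    refine ⟨{ω | g₀ ω = 1}, hg₀ (measurableSet_singleton 1), fun q hq => ?_, fun F _ hF q hq => ?_⟩
    · rw [measure_eq_zero_iff_ae_notMem]
      filter_upwards [hT q hq] with ω hω h
      exact h.2 (hω.2 h.1)
    · rw [measure_eq_zero_iff_ae_notMem]
      filter_upwards [hT q hq, measure_eq_zero_iff_ae_notMem.1 (hF q hq)] with ω hω hωF h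
      exact hωF ⟨hω.1 h.1, h.2⟩
end

section
/- Let 𝒫 be pre-Hahn-localizable on (Ω, ℱ) with localization 𝒬 and supports {S_Q}. Then for every μ ∈ ca(𝒫): (i) the set 𝒬(μ) = {Q ∈ 𝒬 : |μ|(S_Q) > 0} is at most countable; (ii) |μ|(Ω \ ⋃_{Q∈𝒬(μ)} S_Q) = 0, and consequently μ(F) = ∑_{Q∈𝒬(μ)} μ(F ∩ S_Q) for every F ∈ ℱ; (iii) in particular, every P ∈ 𝒫 satisfies P(⋃_{Q∈𝒬(P)} S_Q) = 1, where 𝒬(P) = {Q ∈ 𝒬 : P(S_Q) > 0}. -/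
open MeasureTheory Set
open scoped ENNReal

variable {Ω : Type*}

section Support

variable [MeasurableSpace Ω] {P Q : Set (Measure Ω)} {S : Measure Ω → Set Ω} {ν : Measure Ω}

/-- A measure dominated by a member of `P` charges only countably many supports, is carried by
them, and does not charge the intersection of two distinct ones. -/
theorem IsPreHahnLoc.support_of_ac (hpre : IsPreHahnLoc P Q S) (hν : ∃ p ∈ P, ν ≪ p) :
    {q | q ∈ Q ∧ 0 < ν (S q)}.Countable ∧
    ν ((⋃ q ∈ {q | q ∈ Q ∧ 0 < ν (S q)}, S q)ᶜ) = 0 ∧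
    ∀ q ∈ Q, ∀ r ∈ Q, q ≠ r → ν (S q ∩ S r) = 0 := by
  obtain ⟨p, hp, hνp⟩ := hν
  obtain ⟨_, ⟨f, l, hf, -, rfl⟩, hps⟩ := hpre.ps p hp
  have null : ∀ A, (∀ k, f k A = 0) → ν A = 0 := fun A hA ↦
    (hνp.trans hps) (by simp [Measure.sum_apply_eq_zero, hA])
  have sub : {q | q ∈ Q ∧ 0 < ν (S q)} ⊆ range f := by
    rintro q ⟨hq, hpos⟩
    by_contra hqf
    exact hpos.ne' (null _ fun k ↦ hpre.other _ (hf k) _ hq fun h ↦ hqf ⟨k, h⟩)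
  refine ⟨(countable_range f).mono sub, ?_, fun q hq r hr hqr ↦ null _ fun k ↦ ?_⟩
  · have h1 : ν ((⋃ k, S (f k))ᶜ) = 0 := null _ fun k ↦ by
      have := hpre.probQ _ (hf k)
      refine measure_mono_null (compl_subset_compl.2 (subset_iUnion _ k)) ?_
      exact (prob_compl_eq_zero_iff (hpre.measS _ (hf k))).2 (hpre.self _ (hf k))
    have h2 : ν (⋃ k ∈ {k | ν (S (f k)) = 0}, S (f k)) = 0 :=
      (measure_biUnion_null_iff (to_countable _)).2 fun k hk ↦ hk
    refine measure_mono_null (fun x hx ↦ ?_) (measure_union_null h1 h2)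
    simp only [mem_compl_iff, mem_iUnion, mem_union, mem_ofPred_eq, exists_prop, not_exists,
      not_and] at hx ⊢
    by_contra! hcon
    obtain ⟨⟨k, hk⟩, h⟩ := hcon
    exact hx (f k) ⟨hf k, pos_iff_ne_zero.2 fun h0 ↦ h k h0 hk⟩ hk
  · by_cases hk : f k = q
    · exact measure_mono_null inter_subset_right (hpre.other _ (hf k) _ hr (hk ▸ hqr))
    · exact measure_mono_null inter_subset_left (hpre.other _ (hf k) _ hq hk)

end Support

/-- Countable additivity of a finite measure along an almost everywhere disjoint family carrying
it. -/
theorem hasSum_measureReal_inter {ι : Type*} [Countable ι] [MeasurableSpace Ω] {ν : Measure Ω}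
    [IsFiniteMeasure ν] {A : ι → Set Ω} (hA : ∀ i, MeasurableSet (A i))
    (hd : Pairwise (Function.onFun (AEDisjoint ν) A)) (hcompl : ν (⋃ i, A i)ᶜ = 0) {F : Set Ω}
    (hF : MeasurableSet F) : HasSum (fun i ↦ ν.real (F ∩ A i)) (ν.real F) := by
  have h : ν F = ∑' i, ν (F ∩ A i) := by
    rw [← measure_iUnion₀ (fun i j hij ↦ (hd hij).mono inter_subset_right inter_subset_right)
      fun i ↦ (hF.inter (hA i)).nullMeasurableSet, ← inter_iUnion]
    exact (measure_inter_conull hcompl).symm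
  have hne : ∑' i, ν (F ∩ A i) ≠ ∞ := h ▸ measure_ne_top ν F
  have := ENNReal.hasSum_toReal hne
  rwa [← ENNReal.tsum_toReal_eq fun i ↦ measure_ne_top _ _, ← h] at this

/-- For a pre-Hahn-localizable `P` with localization `Q` and supports `S`,
and `μ ∈ ca(P)`: the set `Q(μ)` is at most countable, `|μ|` vanishes outside
`⋃_{q ∈ Q(μ)} S q`, `μ(F) = ∑_{q ∈ Q(μ)} μ(F ∩ S q)` for every measurable `F`, and every
`p ∈ P` satisfies `p (⋃_{q ∈ Q(p)} S q) = 1`. -/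
theorem stmt2 [MeasurableSpace Ω] (P Q : Set (Measure Ω)) (S : Measure Ω → Set Ω)
    (hpre : IsPreHahnLoc P Q S) (μ : SignedMeasure Ω)
    (hμ : ∃ p ∈ P, μ.totalVariation ≪ p) :
    {q | q ∈ Q ∧ 0 < μ.totalVariation (S q)}.Countable ∧
    μ.totalVariation ((⋃ q ∈ {q | q ∈ Q ∧ 0 < μ.totalVariation (S q)}, S q)ᶜ) = 0 ∧
    (∀ F : Set Ω, MeasurableSet F →
      HasSum (fun q : {q // q ∈ Q ∧ 0 < μ.totalVariation (S q)} => μ (F ∩ S q.1)) (μ F)) ∧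
    (∀ p ∈ P, p (⋃ q ∈ {q | q ∈ Q ∧ 0 < p (S q)}, S q) = 1) := by
  obtain ⟨hc, hcompl, hd⟩ := hpre.support_of_ac hμ
  refine ⟨hc, hcompl, fun F hF ↦ ?_, fun p hp ↦ ?_⟩
  · have : Countable {q // q ∈ Q ∧ 0 < μ.totalVariation (S q)} := hc.to_subtype
    have key (ν : Measure Ω) [IsFiniteMeasure ν] (hν : ν ≤ μ.totalVariation) :
        HasSum (fun q : {q // q ∈ Q ∧ 0 < μ.totalVariation (S q)} ↦ ν.real (F ∩ S q.1))
          (ν.real F) := by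
      refine hasSum_measureReal_inter (fun q ↦ hpre.measS _ q.2.1) (fun q r hqr ↦ ?_) ?_ hF
      · exact hν.absolutelyContinuous
          (hd _ q.2.1 _ r.2.1 fun h ↦ hqr (Subtype.ext h))
      · apply hν.absolutelyContinuous
        rwa [biUnion_eq_iUnion] at hcompl
    have eq (A : Set Ω) (hA : MeasurableSet A) : μ A =
        μ.toJordanDecomposition.posPart.real A - μ.toJordanDecomposition.negPart.real A := by
      conv_lhs => rw [← μ.toSignedMeasure_toJordanDecomposition]
      rw [JordanDecomposition.toSignedMeasure, sub_apply,
        Measure.toSignedMeasure_apply_measurable hA, Measure.toSignedMeasure_apply_measurable hA]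
    rw [eq F hF, funext fun q : {q // q ∈ Q ∧ 0 < μ.totalVariation (S q)} ↦
      eq _ (hF.inter (hpre.measS _ q.2.1))]
    exact (key _ (Measure.le_add_right le_rfl)).sub (key _ (Measure.le_add_left le_rfl))
  · obtain ⟨hc, hcompl, -⟩ := hpre.support_of_ac ⟨p, hp, Measure.AbsolutelyContinuous.rfl⟩
    have := hpre.probP p hp
    exact (prob_compl_eq_zero_iff (.biUnion hc fun q hq ↦ hpre.measS _ hq.1)).1 hcompl
end

section
/- Let 𝒫 be pre-Hahn-localizable on (Ω, ℱ) with localization 𝒬. Then ℱ^𝒫 = ℱ^𝒬, i.e. a set A ⊆ Ω can be written as A = F ∪ Z with F ∈ ℱ and Z contained in a P-null set of ℱ for every P ∈ 𝒫, if and only if the same holds for every Q ∈ 𝒬. -/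
open MeasureTheory Set
open scoped ENNReal

variable {Ω : Type*}

/-- `A` belongs to the `p`-completion of the σ-algebra: `A = F ∪ Z` with `F` measurable and
`Z` contained in a `p`-null measurable set. -/
def MemCompletion [MeasurableSpace Ω] (p : Measure Ω) (A : Set Ω) : Prop :=
  ∃ F Z N : Set Ω, MeasurableSet F ∧ MeasurableSet N ∧ p N = 0 ∧ Z ⊆ N ∧ A = F ∪ Z

theorem memCompletion_iff_nullMeasurableSet [MeasurableSpace Ω] {p : Measure Ω} {A : Set Ω} :
    MemCompletion p A ↔ NullMeasurableSet A p := by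
  constructor
  · rintro ⟨F, Z, N, hF, -, hN, hZ, rfl⟩
    exact hF.nullMeasurableSet.union_null (measure_mono_null hZ hN)
  · intro h
    obtain ⟨F, hFA, hF, hae⟩ := h.exists_measurable_subset_ae_eq
    refine ⟨F, A \ F, toMeasurable p (A \ F), hF, measurableSet_toMeasurable _ _, ?_,
      subset_toMeasurable _ _, (union_sdiff_cancel hFA).symm⟩
    rw [measure_toMeasurable]
    exact ae_le_set.1 hae.symm.le

/-- Null measurability passes to countable sums of measures that are pairwise equal or
separated by measurable supports. -/
theorem nullMeasurableSet_sum_of_supports [MeasurableSpace Ω] {ι : Type*} [Countable ι]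
    {f : ι → Measure Ω} {S : Measure Ω → Set Ω} (hS : ∀ k, MeasurableSet (S (f k)))
    (hself : ∀ k, f k (S (f k))ᶜ = 0) (hother : ∀ j k, f j ≠ f k → f j (S (f k)) = 0)
    {A : Set Ω} (hA : ∀ k, NullMeasurableSet A (f k)) :
    NullMeasurableSet A (Measure.sum f) := by
  have piece (k : ι) : NullMeasurableSet (A ∩ S (f k)) (Measure.sum f) := by
    obtain ⟨F, -, hF, hFA⟩ := (hA k).exists_measurable_subset_ae_eq
    refine (hF.inter (hS k)).nullMeasurableSet.congr ?_
    refine Measure.ae_sum_iff.2 fun j ↦ ?_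
    by_cases hjk : f j = f k
    · rw [hjk]
      exact hFA.inter (ae_eq_refl _)
    · exact (ae_eq_empty.2 (measure_mono_null inter_subset_right (hother j k hjk))).trans
        (ae_eq_empty.2 (measure_mono_null inter_subset_right (hother j k hjk))).symm
  have rest : Measure.sum f (A \ ⋃ k, S (f k)) = 0 :=
    Measure.sum_apply_eq_zero.2 fun j ↦ measure_mono_null
      (fun _ hx hxS ↦ hx.2 (mem_iUnion_of_mem j hxS) : A \ ⋃ k, S (f k) ⊆ (S (f j))ᶜ) (hself j)
  rw [← inter_union_sdiff A (⋃ k, S (f k)), inter_iUnion]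
  exact (NullMeasurableSet.iUnion piece).union_null rest

/-- For a pre-Hahn-localizable `P` with localization `Q`,
the completions coincide: `ℱ^P = ℱ^Q`. -/
theorem stmt3 [MeasurableSpace Ω] (P Q : Set (Measure Ω)) (S : Measure Ω → Set Ω)
    (hpre : IsPreHahnLoc P Q S) :
    ∀ A : Set Ω, (∀ p ∈ P, MemCompletion p A) ↔ (∀ q ∈ Q, MemCompletion q A) := by
  intro A
  simp only [memCompletion_iff_nullMeasurableSet]
  constructor
  · intro h q hq
    obtain ⟨p, hp, hqp⟩ := hpre.qp q hq
    exact (h p hp).mono_ac hqp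
  · intro h p hp
    obtain ⟨_, ⟨f, l, hf, -, rfl⟩, hp_ac⟩ := hpre.ps p hp
    have hself (k : ℕ) : f k (S (f k))ᶜ = 0 := by
      have := hpre.probQ _ (hf k)
      exact (prob_compl_eq_zero_iff (hpre.measS _ (hf k))).2 (hpre.self _ (hf k))
    have hsum : NullMeasurableSet A (Measure.sum f) :=
      nullMeasurableSet_sum_of_supports (fun k ↦ hpre.measS _ (hf k)) hself
        (fun j k hjk ↦ hpre.other _ (hf j) _ (hf k) hjk) fun k ↦ h _ (hf k)
    refine hsum.mono_ac (hp_ac.trans (Measure.absolutelyContinuous_sum_left fun k ↦ ?_))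
    exact (Measure.AbsolutelyContinuous.rfl.smul_left (l k)).trans
      (Measure.absolutelyContinuous_sum_right k Measure.AbsolutelyContinuous.rfl)
end

section
/- Let 𝒫 be Hahn-localizable on (Ω, ℱ) with localization 𝒬 whose supports S_Q are pairwise disjoint, and let each measure in 𝒬 and 𝒫 be (uniquely) extended to the completion ℱ^𝒫. Then (Ω, ℱ^𝒫, 𝒫) is Hahn-localizable with the same localization: (i) 𝒬 ⋘ 𝒫 ⋘ sconv(𝒬) holds with absolute continuity tested on sets of ℱ^𝒫; (ii) for every family {E_Q}_{Q∈𝒬} with E_Q ∈ ℱ^𝒫 and E_Q ⊆ S_Q there exists S ∈ ℱ^𝒫 such that Q(E_Q \ S) = 0 for all Q ∈ 𝒬, and whenever F ∈ ℱ^𝒫 satisfies Q(E_Q \ F) = 0 for all Q ∈ 𝒬, then Q(S \ F) = 0 for all Q ∈ 𝒬. -/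
open MeasureTheory Set
open scoped ENNReal

variable {Ω : Type*}

/-- `P` is Hahn-localizable with localization `Q` and supports `S`. -/
def IsHahnLoc [MeasurableSpace Ω] (P Q : Set (Measure Ω)) (S : Measure Ω → Set Ω) : Prop :=
  IsPreHahnLoc P Q S ∧
    ∀ E : Measure Ω → Set Ω, (∀ q ∈ Q, MeasurableSet (E q) ∧ E q ⊆ S q) →
      ∃ T : Set Ω, HasEssSup Q E T

theorem MemCompletion.of_measurableSet [MeasurableSpace Ω] {p : Measure Ω} {A : Set Ω}
    (hA : MeasurableSet A) : MemCompletion p A :=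
  ⟨A, ∅, ∅, hA, MeasurableSet.empty, measure_empty, Subset.rfl, (union_empty A).symm⟩

theorem MemCompletion.exists_measurableSet_subset [MeasurableSpace Ω] {p q : Measure Ω}
    {A : Set Ω} (hA : MemCompletion p A) (hqp : q ≪ p) :
    ∃ G, MeasurableSet G ∧ G ⊆ A ∧ q (A \ G) = 0 := by
  obtain ⟨F, Z, N, hF, -, hN, hZN, rfl⟩ := hA
  refine ⟨F, hF, subset_union_left, measure_mono_null ?_ (hqp hN)⟩
  rw [union_sdiff_left]
  exact sdiff_subset.trans hZN

/-- An essential supremum of `E` is, up to a `q`-null set, contained in `E q`. -/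
theorem HasEssSup.measure_diff_eq_zero [MeasurableSpace Ω] {P Q : Set (Measure Ω)}
    {S E : Measure Ω → Set Ω} {T : Set Ω} (hPQ : IsPreHahnLoc P Q S)
    (hE : ∀ q ∈ Q, MeasurableSet (E q)) (hT : HasEssSup Q E T)
    {q : Measure Ω} (hq : q ∈ Q) : q (T \ E q) = 0 := by
  have := hPQ.probQ q hq
  have hSc : q (S q)ᶜ = 0 := (prob_compl_eq_zero_iff (hPQ.measS q hq)).2 (hPQ.self q hq)
  have hH : q (T \ (E q ∪ (S q)ᶜ)) = 0 := by
    refine hT.2.2 _ ((hE q hq).union (hPQ.measS q hq).compl) (fun r hr => ?_) q hq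
    by_cases h : r = q
    · subst h
      rw [sdiff_eq_empty.2 subset_union_left, measure_empty]
    · refine measure_mono_null (fun x hx => ?_) (hPQ.other r hr q hq h)
      by_contra hxS
      exact hx.2 (Or.inr hxS)
  refine measure_mono_null (fun x hx => ?_) (measure_union_null hH hSc)
  by_cases hxS : x ∈ S q
  · exact Or.inl ⟨hx.1, fun h => h.elim hx.2 fun h => h hxS⟩
  · exact Or.inr hxS

/-- If `P` is Hahn-localizable with strictly disjointly supported
localization `Q`, then, extending each measure to the completion `ℱ^P` (the extension agrees
with the outer-measure values on `ℱ^P`-sets), the completed model is Hahn-localizable with the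
same localization: (i) `Q ⋘ P ⋘ sconv Q` with absolute continuity tested on `ℱ^P`-sets, and
(ii) every family `{E_q}` of sets of `ℱ^P` with `E_q ⊆ S q` has an essential supremum in
`ℱ^P`. -/
theorem stmt5 [MeasurableSpace Ω] (P Q : Set (Measure Ω)) (S : Measure Ω → Set Ω)
    (hH : IsHahnLoc P Q S)
    (hdisj : ∀ q ∈ Q, ∀ r ∈ Q, q ≠ r → Disjoint (S q) (S r)) :
    (∀ q ∈ Q, ∃ p ∈ P, ∀ A : Set Ω, (∀ p' ∈ P, MemCompletion p' A) → p A = 0 → q A = 0) ∧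
    (∀ p ∈ P, ∃ R ∈ sconv Q, ∀ A : Set Ω, (∀ p' ∈ P, MemCompletion p' A) → R A = 0 → p A = 0) ∧
    (∀ E : Measure Ω → Set Ω,
      (∀ q ∈ Q, (∀ p ∈ P, MemCompletion p (E q)) ∧ E q ⊆ S q) →
      ∃ T : Set Ω, (∀ p ∈ P, MemCompletion p T) ∧
        (∀ q ∈ Q, q (E q \ T) = 0) ∧
        ∀ F : Set Ω, (∀ p ∈ P, MemCompletion p F) →
          (∀ q ∈ Q, q (E q \ F) = 0) → ∀ q ∈ Q, q (T \ F) = 0) := by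
  obtain ⟨hPQ, hsup⟩ := hH
  refine ⟨fun q hq => ?_, fun p hp => ?_, fun E hE => ?_⟩
  · obtain ⟨p, hp, hqp⟩ := hPQ.qp q hq
    exact ⟨p, hp, fun A _ hA => hqp hA⟩
  · obtain ⟨R, hR, hpR⟩ := hPQ.ps p hp
    exact ⟨R, hR, fun A _ hA => hpR hA⟩
  · have hG : ∀ q, ∃ G, q ∈ Q → MeasurableSet G ∧ G ⊆ E q ∧ q (E q \ G) = 0 := fun q => by
      by_cases hq : q ∈ Q
      · obtain ⟨p, hp, hqp⟩ := hPQ.qp q hq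
        obtain ⟨G, h⟩ := ((hE q hq).1 p hp).exists_measurableSet_subset hqp
        exact ⟨G, fun _ => h⟩
      · exact ⟨∅, fun h => absurd h hq⟩
    choose G hG using hG
    obtain ⟨T, hT⟩ := hsup G fun q hq => ⟨(hG q hq).1, (hG q hq).2.1.trans (hE q hq).2⟩
    refine ⟨T, fun p _ => .of_measurableSet hT.1, fun q hq => ?_, fun F _ hF q hq => ?_⟩
    · exact measure_mono_null (sdiff_triangle _ (G q) _)
        (measure_union_null (hG q hq).2.2 (hT.2.1 q hq))
    · exact measure_mono_null (sdiff_triangle _ (G q) _)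
        (measure_union_null (hT.measure_diff_eq_zero hPQ (fun r hr => (hG r hr).1) hq)
          (measure_mono_null (sdiff_subset_sdiff_left (hG q hq).2.1) (hF q hq)))
end

section
/- Let (Ω, ℱ) be a measurable space and 𝒫 a σ-convex family of probability measures on ℱ. Then the following are equivalent: (1) there exists a family ℛ of probability measures on ℱ having the same polar sets as 𝒫, such that each R ∈ ℛ is supported with support S_R ∈ ℱ, the supports are 𝒫-q.s. pairwise disjoint (S_R ∩ S_{R'} is 𝒫-polar whenever R ≠ R'), and every P ∈ 𝒫 satisfies P(⋃_{R∈ℛ(P)} S_R) = 1, where ℛ(P) = {R ∈ ℛ : P(S_R) > 0}; (2) 𝒫 is pre-Hahn-localizable. -/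
open MeasureTheory Set
open scoped ENNReal

variable {Ω : Type*}

/-- `R` is supported (relative to `P`) with support `T`: `R(Tᶜ) = 0`, and every measurable
`N` with `R (N ∩ T) = 0` has `N ∩ T` `P`-polar. -/
def Supported [MeasurableSpace Ω] (P : Set (Measure Ω)) (R : Measure Ω) (T : Set Ω) : Prop :=
  MeasurableSet T ∧ R Tᶜ = 0 ∧
    ∀ N : Set Ω, MeasurableSet N → R (N ∩ T) = 0 → ∀ p ∈ P, p (N ∩ T) = 0

/-- Halmos–Savage: a family of s-finite measures dominated by a finite measure is dominated by
a countable subfamily. -/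
theorem exists_seq_absolutelyContinuous_sum [MeasurableSpace Ω] {ι : Type*} [Nonempty ι]
    (μ : Measure Ω) [IsFiniteMeasure μ] (ν : ι → Measure Ω) [∀ i, SFinite (ν i)]
    (hν : ∀ i, ν i ≪ μ) :
    ∃ f : ℕ → ι, ∀ i, ν i ≪ Measure.sum fun n => ν (f n) := by
  let A : ι → Set Ω := fun i => {x | (ν i).rnDeriv μ x ≠ 0}
  have hA : ∀ i, MeasurableSet (A i) := fun i =>
    (Measure.measurable_rnDeriv (ν i) μ) (measurableSet_singleton 0).compl
  have hnull : ∀ i N, ν i N = 0 ↔ μ (A i ∩ N) = 0 := fun i N => by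
    rw [← withDensity_apply_eq_zero (Measure.measurable_rnDeriv (ν i) μ),
      Measure.withDensity_rnDeriv_eq _ _ (hν i)]
  let F : (ℕ → ι) → ℝ≥0∞ := fun f => μ (⋃ n, A (f n))
  obtain ⟨u, -, hu, huF⟩ := exists_seq_tendsto_sSup (range_nonempty F) (OrderTop.bddAbove _)
  choose f hf using huF
  let g : ℕ → ι := fun n => f n.unpair.1 n.unpair.2
  have hle : sSup (range F) ≤ F g := by
    refine le_of_tendsto' hu fun n => ?_
    rw [← hf n]
    refine measure_mono (iUnion_subset fun k => ?_)
    refine subset_iUnion_of_subset (Nat.pair n k) ?_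
    simp [g]
  refine ⟨g, fun i N hN => ?_⟩
  rw [Measure.sum_apply_eq_zero] at hN
  simp only [hnull] at hN
  have hdiff : μ (A i \ ⋃ n, A (g n)) = 0 := by
    have hcons : F (fun n => Nat.casesOn n i g) ≤ F g :=
      (le_sSup (mem_range_self _)).trans hle
    have hunion : A i ∪ ⋃ n, A (g n) ⊆ ⋃ n, A (Nat.casesOn n i g) :=
      union_subset (subset_iUnion_of_subset 0 Subset.rfl)
        (iUnion_subset fun n => subset_iUnion_of_subset (n + 1) Subset.rfl)
    have hm : μ (A i ∪ ⋃ n, A (g n)) ≤ μ (⋃ n, A (g n)) := (measure_mono hunion).trans hcons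
    have hsplit := measure_sdiff_add_inter (μ := μ) (A i ∪ ⋃ n, A (g n))
      (MeasurableSet.iUnion fun n => hA (g n))
    rw [union_sdiff_right, union_inter_cancel_right] at hsplit
    rw [← hsplit] at hm
    exact nonpos_iff_eq_zero.1 <| (ENNReal.add_le_add_iff_right
      (measure_ne_top μ (⋃ n, A (g n)))).1 (hm.trans_eq (zero_add _).symm)
  rw [hnull]
  refine measure_mono_null (t := (A i \ ⋃ n, A (g n)) ∪ ⋃ n, A (g n) ∩ N) ?_
    (measure_union_null hdiff (measure_iUnion_null hN))
  rintro x ⟨hxA, hxN⟩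
  by_cases hx : x ∈ ⋃ n, A (g n)
  · obtain ⟨n, hn⟩ := mem_iUnion.1 hx
    exact Or.inr (mem_iUnion.2 ⟨n, hn, hxN⟩)
  · exact Or.inl ⟨hxA, hx⟩

theorem exists_mem_sconv_forall_absolutelyContinuous [MeasurableSpace Ω] {Q : Set (Measure Ω)}
    (f : ℕ → Measure Ω) (hf : ∀ k, f k ∈ Q) : ∃ μ ∈ sconv Q, ∀ k, f k ≪ μ := by
  refine ⟨_, ⟨f, fun k => (2⁻¹ : ℝ≥0∞) ^ (k + 1), hf, ?_, rfl⟩, fun k N hN => ?_⟩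
  · rw [ENNReal.tsum_geometric_add_one, ENNReal.one_sub_inv_two, inv_inv]
    exact ENNReal.inv_mul_cancel (by simp) (by simp)
  · have := Measure.sum_apply_eq_zero.1 hN k
    simpa using this

theorem apply_eq_zero_of_mem_sconv [MeasurableSpace Ω] {Q : Set (Measure Ω)} {μ : Measure Ω}
    (hμ : μ ∈ sconv Q) {N : Set Ω} (hN : ∀ q ∈ Q, q N = 0) : μ N = 0 := by
  obtain ⟨f, l, hf, -, rfl⟩ := hμ
  rw [Measure.sum_apply_eq_zero]
  intro k
  simp [hN _ (hf k)]

theorem Supported.exists_absolutelyContinuous [MeasurableSpace Ω] {P : Set (Measure Ω)}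
    (hP : ∀ p ∈ P, IsProbabilityMeasure p) (hconv : sconv P ⊆ P) {r : Measure Ω}
    [IsProbabilityMeasure r] {T : Set Ω} (hT : Supported P r T)
    (hpolar : ∀ N, MeasurableSet N → (∀ p ∈ P, p N = 0) → r N = 0) :
    ∃ p ∈ P, r.restrict T ≪ p.restrict T := by
  obtain ⟨hTm, -, hT⟩ := hT
  have hne : P.Nonempty := by
    by_contra hemp
    rw [not_nonempty_iff_eq_empty] at hemp
    simpa using hpolar univ MeasurableSet.univ (by simp [hemp])
  have : Nonempty P := hne.to_subtype
  have : ∀ p : P, IsProbabilityMeasure (p : Measure Ω) := fun p => hP p p.2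
  obtain ⟨f, hf⟩ := exists_seq_absolutelyContinuous_sum (r.restrict T)
    (fun p : P => (p : Measure Ω).restrict T) fun p => .mk fun N hN h0 => by
      rw [Measure.restrict_apply hN] at h0 ⊢
      exact hT N hN h0 p p.2
  obtain ⟨p, hp, hfp⟩ := exists_mem_sconv_forall_absolutelyContinuous
    (fun n => (f n : Measure Ω)) fun n => (f n).2
  refine ⟨p, hconv hp, .mk fun N hN h0 => ?_⟩
  rw [Measure.restrict_apply hN] at h0 ⊢
  refine hpolar _ (hN.inter hTm) fun p' hp' => ?_
  rw [← Measure.restrict_apply hN]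
  refine hf ⟨p', hp'⟩ (Measure.sum_apply_eq_zero.2 fun n => ?_)
  rw [Measure.restrict_apply hN]
  exact hfp n h0

theorem IsPreHahnLoc.polar_iff [MeasurableSpace Ω] {P Q : Set (Measure Ω)}
    {S : Measure Ω → Set Ω} (h : IsPreHahnLoc P Q S) (N : Set Ω) :
    (∀ p ∈ P, p N = 0) ↔ ∀ q ∈ Q, q N = 0 := by
  refine ⟨fun hN q hq => ?_, fun hN p hp => ?_⟩
  · obtain ⟨p, hp, hqp⟩ := h.qp q hq
    exact hqp (hN p hp)
  · obtain ⟨μ, hμ, hpμ⟩ := h.ps p hp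
    exact hpμ (apply_eq_zero_of_mem_sconv hμ hN)

theorem IsPreHahnLoc.supported [MeasurableSpace Ω] {P Q : Set (Measure Ω)}
    {S : Measure Ω → Set Ω} (h : IsPreHahnLoc P Q S) {q : Measure Ω} (hq : q ∈ Q) :
    Supported P q (S q) := by
  have := h.probQ q hq
  refine ⟨h.measS q hq, (prob_compl_eq_zero_iff (h.measS q hq)).2 (h.self q hq),
    fun N _ h0 => (h.polar_iff _).2 fun q' hq' => ?_⟩
  by_cases hqq : q' = q
  · rwa [hqq]
  · exact measure_mono_null inter_subset_right (h.other q' hq' q hq hqq)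

theorem IsPreHahnLoc.apply_inter_eq_zero [MeasurableSpace Ω] {P Q : Set (Measure Ω)}
    {S : Measure Ω → Set Ω} (h : IsPreHahnLoc P Q S) {q q' : Measure Ω} (hq : q ∈ Q)
    (hq' : q' ∈ Q) (hne : q ≠ q') : ∀ p ∈ P, p (S q ∩ S q') = 0 := by
  refine (h.polar_iff _).2 fun s hs => ?_
  by_cases hsq : s = q
  · exact measure_mono_null inter_subset_right (h.other s hs q' hq' (hsq ▸ hne))
  · exact measure_mono_null inter_subset_left (h.other s hs q hq hsq)

theorem IsPreHahnLoc.apply_biUnion_eq_one [MeasurableSpace Ω] {P Q : Set (Measure Ω)}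
    {S : Measure Ω → Set Ω} (h : IsPreHahnLoc P Q S) {p : Measure Ω} (hp : p ∈ P) :
    p (⋃ q ∈ {q | q ∈ Q ∧ 0 < p (S q)}, S q) = 1 := by
  have := h.probP p hp
  obtain ⟨_, ⟨f, l, hf, -, rfl⟩, hac⟩ := h.ps p hp
  have hU : p (⋃ k, S (f k))ᶜ = 0 := by
    refine hac (Measure.sum_apply_eq_zero.2 fun k => ?_)
    have hk : f k (⋃ k, S (f k))ᶜ = 0 :=
      measure_mono_null (compl_subset_compl.2 (subset_iUnion (fun k => S (f k)) k))
        (h.supported (hf k)).2.1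
    rw [Measure.smul_apply, hk, smul_zero]
  have hN : p (⋃ k ∈ {k | p (S (f k)) = 0}, S (f k)) = 0 :=
    (measure_biUnion_null_iff (to_countable _)).2 fun k hk => hk
  have hcompl : p (⋃ q ∈ {q | q ∈ Q ∧ 0 < p (S q)}, S q)ᶜ = 0 := by
    refine measure_mono_null (fun x hx => ?_) (measure_union_null hU hN)
    by_cases hxU : x ∈ ⋃ k, S (f k)
    · obtain ⟨k, hk⟩ := mem_iUnion.1 hxU
      refine Or.inr (mem_biUnion (show p (S (f k)) = 0 from ?_) hk)
      by_contra h0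
      exact hx (mem_biUnion (x := f k) ⟨hf k, pos_iff_ne_zero.2 h0⟩ hk)
    · exact Or.inl hxU
  rw [measure_of_measure_compl_eq_zero hcompl, measure_univ]

theorem countable_pos_of_pairwise_null_inter [MeasurableSpace Ω] (p : Measure Ω) [SFinite p]
    {R : Set (Measure Ω)} {S : Measure Ω → Set Ω} (hS : ∀ r ∈ R, MeasurableSet (S r))
    (hdisj : ∀ r ∈ R, ∀ r' ∈ R, r ≠ r' → p (S r ∩ S r') = 0) :
    {r | r ∈ R ∧ 0 < p (S r)}.Countable := by
  have hc := Measure.countable_meas_pos_of_disjoint_iUnion₀ (μ := p)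
    (As := fun r : R => S r) (fun r => (hS r r.2).nullMeasurableSet)
    fun r r' hne => hdisj r r.2 r' r'.2 (Subtype.coe_injective.ne hne)
  refine (hc.image Subtype.val).mono ?_
  rintro r ⟨hr, hpos⟩
  exact ⟨⟨r, hr⟩, hpos, rfl⟩

theorem exists_isPreHahnLoc_of_supported [MeasurableSpace Ω] {P R : Set (Measure Ω)}
    {S : Measure Ω → Set Ω} (hP : ∀ p ∈ P, IsProbabilityMeasure p) (hconv : sconv P ⊆ P)
    (hR : ∀ r ∈ R, IsProbabilityMeasure r)
    (hpolar : ∀ N, MeasurableSet N → (∀ p ∈ P, p N = 0) → ∀ r ∈ R, r N = 0)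
    (hsupp : ∀ r ∈ R, Supported P r (S r))
    (hdisj : ∀ r ∈ R, ∀ r' ∈ R, r ≠ r' → ∀ p ∈ P, p (S r ∩ S r') = 0)
    (hunion : ∀ p ∈ P, p (⋃ r ∈ {r | r ∈ R ∧ 0 < p (S r)}, S r) = 1) :
    ∃ (Q : Set (Measure Ω)) (T : Measure Ω → Set Ω), IsPreHahnLoc P Q T := by
  have hdom : ∀ r ∈ R, ∃ p ∈ P, r.restrict (S r) ≪ p.restrict (S r) := fun r hr =>
    have := hR r hr
    (hsupp r hr).exists_absolutelyContinuous hP hconv fun N hN h0 => hpolar N hN h0 r hr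
  choose! d hdP hd using hdom
  have hself : ∀ r ∈ R, d r (S r) ≠ 0 := by
    intro r hr h0
    have := hR r hr
    have hr0 : r (S r) = 0 := by
      have := @hd r hr univ
      simpa [h0] using this
    have := (prob_compl_eq_zero_iff (hsupp r hr).1).1 (hsupp r hr).2.1
    simp [hr0] at this
  let c : Measure Ω → Measure Ω := fun r => ProbabilityTheory.cond (d r) (S r)
  have hcself : ∀ r ∈ R, c r (S r) = 1 := fun r hr =>
    have := hP _ (hdP r hr)
    ProbabilityTheory.cond_apply_self (hself r hr) (measure_ne_top _ _)
  have hcother : ∀ r ∈ R, ∀ r' ∈ R, r ≠ r' → c r (S r') = 0 := fun r hr r' hr' hne => by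
    rw [ProbabilityTheory.cond_apply (hsupp r hr).1, hdisj r hr r' hr' hne _ (hdP r hr), mul_zero]
  have hinj : InjOn c R := fun r hr r' hr' heq => by
    by_contra hne
    have := hcother r hr r' hr' hne
    rw [heq, hcself r' hr'] at this
    exact one_ne_zero this
  have hTc : ∀ r ∈ R, S (Function.invFunOn c R (c r)) = S r := fun r hr => by
    rw [hinj.leftInvOn_invFunOn hr]
  refine ⟨c '' R, fun q => S (Function.invFunOn c R q), hP, ?_, ?_, ?_, ?_, ?_, ?_⟩
  · rintro _ ⟨r, hr, rfl⟩
    have := hP _ (hdP r hr)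
    exact ProbabilityTheory.cond_isProbabilityMeasure (hself r hr)
  · rintro _ ⟨r, hr, rfl⟩
    rw [hTc r hr]
    exact (hsupp r hr).1
  · rintro _ ⟨r, hr, rfl⟩
    rw [hTc r hr]
    exact hcself r hr
  · rintro _ ⟨r, hr, rfl⟩ _ ⟨r', hr', rfl⟩ hne
    rw [hTc r' hr']
    exact hcother r hr r' hr' fun h => hne (h ▸ rfl)
  · rintro _ ⟨r, hr, rfl⟩
    exact ⟨d r, hdP r hr, ProbabilityTheory.cond_absolutelyContinuous⟩
  · intro p hp
    have := hP p hp
    have hcount := countable_pos_of_pairwise_null_inter p (fun r hr => (hsupp r hr).1)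
      fun r hr r' hr' hne => hdisj r hr r' hr' hne p hp
    have hne : {r | r ∈ R ∧ 0 < p (S r)}.Nonempty := by
      by_contra hemp
      have := hunion p hp
      rw [not_nonempty_iff_eq_empty.1 hemp] at this
      simp at this
    obtain ⟨f, hf⟩ := hcount.exists_eq_range hne
    have hfR : ∀ k, f k ∈ R := fun k => (hf.ge (mem_range_self k)).1
    obtain ⟨μ, hμ, hfμ⟩ := exists_mem_sconv_forall_absolutelyContinuous
      (fun k => c (f k)) fun k => mem_image_of_mem c (hfR k)
    refine ⟨μ, hμ, .mk fun N hN h0 => ?_⟩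
    have hU := hunion p hp
    rw [hf, biUnion_range] at hU
    have hUc : p (⋃ k, S (f k))ᶜ = 0 :=
      (prob_compl_eq_zero_iff (.iUnion fun k => (hsupp _ (hfR k)).1)).2 hU
    have hk : ∀ k, p (N ∩ S (f k)) = 0 := fun k => by
      have := hP _ (hdP _ (hfR k))
      refine (hsupp _ (hfR k)).2.2 N hN ?_ p hp
      rw [← Measure.restrict_apply hN]
      refine hd _ (hfR k) ?_
      have hc0 : c (f k) N = 0 := hfμ k h0
      rw [ProbabilityTheory.cond_apply (hsupp _ (hfR k)).1, mul_eq_zero] at hc0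
      rw [Measure.restrict_apply hN, inter_comm]
      exact hc0.resolve_left (ENNReal.inv_ne_zero.2 (measure_ne_top _ _))
    refine measure_mono_null (fun x hx => ?_) (measure_union_null hUc (measure_iUnion_null hk))
    by_cases hxU : x ∈ ⋃ k, S (f k)
    · obtain ⟨k, hxk⟩ := mem_iUnion.1 hxU
      exact Or.inr (mem_iUnion.2 ⟨k, hx, hxk⟩)
    · exact Or.inl hxU

/-- For a σ-convex family `P` of probability measures, the following are
equivalent: (1) there is a family `R` of supported probability measures with the same polar
sets as `P`, with `P`-q.s. pairwise disjoint supports, and with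
`p (⋃_{r ∈ R(p)} S r) = 1` for every `p ∈ P`; (2) `P` is pre-Hahn-localizable. -/
theorem stmt6 [MeasurableSpace Ω] (P : Set (Measure Ω))
    (hP : ∀ p ∈ P, IsProbabilityMeasure p) (hconv : sconv P = P) :
    (∃ (R : Set (Measure Ω)) (S : Measure Ω → Set Ω),
      (∀ r ∈ R, IsProbabilityMeasure r) ∧
      (∀ N : Set Ω, MeasurableSet N → ((∀ p ∈ P, p N = 0) ↔ ∀ r ∈ R, r N = 0)) ∧
      (∀ r ∈ R, Supported P r (S r)) ∧
      (∀ r ∈ R, ∀ r' ∈ R, r ≠ r' → ∀ p ∈ P, p (S r ∩ S r') = 0) ∧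
      (∀ p ∈ P, p (⋃ r ∈ {r | r ∈ R ∧ 0 < p (S r)}, S r) = 1)) ↔
    (∃ (Q : Set (Measure Ω)) (S : Measure Ω → Set Ω), IsPreHahnLoc P Q S) := by
  constructor
  · rintro ⟨R, S, hR, hpolar, hsupp, hdisj, hunion⟩
    exact exists_isPreHahnLoc_of_supported hP hconv.subset hR (fun N hN => (hpolar N hN).1)
      hsupp hdisj hunion
  · rintro ⟨Q, S, h⟩
    exact ⟨Q, S, h.probQ, fun N _ => h.polar_iff N, fun _ hq => h.supported hq,
      fun _ hq _ hq' hne => h.apply_inter_eq_zero hq hq' hne,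
      fun _ hp => h.apply_biUnion_eq_one hp⟩
end

section
/- Let (Ω, ℱ) be a measurable space, μ a finite signed measure on ℱ, and (μ_k)_{k≥1} a sequence of pairwise mutually singular finite signed measures on ℱ such that μ(F) = ∑_{k=1}^∞ μ_k(F) for every F ∈ ℱ. Then the series ∑_{k=1}^∞ μ_k converges to μ in the total variation norm, and the total variation measures satisfy |μ|(F) = ∑_{k=1}^∞ |μ_k|(F) for every F ∈ ℱ. -/
open MeasureTheory Set Filter Topology
open scoped ENNReal

variable {Ω : Type*}

/-- Countably many pairwise mutually singular measures are carried by pairwise disjoint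
measurable sets. -/
theorem exists_pairwise_disjoint_carriers [MeasurableSpace Ω] {ι : Type*} [Countable ι]
    {m : ι → Measure Ω} (h : Pairwise fun k l => (m k).MutuallySingular (m l)) :
    ∃ A : ι → Set Ω, (∀ k, MeasurableSet (A k)) ∧ Pairwise (Function.onFun Disjoint A) ∧
      ∀ k, m k (A k)ᶜ = 0 := by
  choose S hS hS₁ hS₂ using h
  refine ⟨fun k => ⋂ (l) (hl : k ≠ l), (S hl)ᶜ ∩ S hl.symm, fun k => ?_, fun k l hkl => ?_,
    fun k => ?_⟩
  · exact .iInter fun l => .iInter fun hl => (hS hl).compl.inter (hS hl.symm)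
  · refine Set.disjoint_left.2 fun x hx hx' => ?_
    simp only [mem_iInter, mem_inter_iff] at hx hx'
    exact (hx l hkl).1 (hx' k hkl.symm).2
  · simp only [compl_iInter, compl_inter, compl_compl, measure_iUnion_null_iff]
    exact fun l hl => measure_union_null (hS₁ hl) (hS₂ hl.symm)

/-- Total variation commutes with restriction to a measurable set. -/
theorem totalVariation_restrict [MeasurableSpace Ω] (μ : SignedMeasure Ω) {A : Set Ω}
    (hA : MeasurableSet A) :
    SignedMeasure.totalVariation (μ.restrict A) = μ.totalVariation.restrict A := by
  rw [SignedMeasure.totalVariation_eq_variation, SignedMeasure.totalVariation_eq_variation,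
    VectorMeasure.variation_restrict hA]

/-- Restricting a signed measure to a finite disjoint union of measurable sets gives the sum of
the restrictions. -/
theorem restrict_biUnion_finset [MeasurableSpace Ω] {ι : Type*} (μ : SignedMeasure Ω)
    {A : ι → Set Ω} (hA : ∀ k, MeasurableSet (A k)) (hd : Pairwise (Function.onFun Disjoint A))
    (s : Finset ι) :
    μ.restrict (⋃ k ∈ s, A k) = ∑ k ∈ s, μ.restrict (A k) := by
  classical
  induction s using Finset.induction_on with
  | empty => simp
  | insert a s ha ih =>
    rw [Finset.set_biUnion_insert, Finset.sum_insert ha, ← ih]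
    refine VectorMeasure.restrict_union ?_ (hA a) (s.measurableSet_biUnion fun k _ => hA k)
    refine Set.disjoint_iUnion₂_right.2 fun k hk => hd ?_
    rintro rfl
    exact ha hk

/-- If `μ` is a finite signed measure and `(μ_k)` are pairwise mutually
singular finite signed measures with `μ(F) = ∑_{k} μ_k(F)` for every measurable `F`, then the
series `∑_k μ_k` converges to `μ` in total variation norm, and
`|μ|(F) = ∑_k |μ_k|(F)` for every measurable `F`. -/
theorem stmt7 [MeasurableSpace Ω] (μ : SignedMeasure Ω) (μs : ℕ → SignedMeasure Ω)
    (hsing : Pairwise fun k l => μs k ⟂ᵥ μs l)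
    (hsum : ∀ F : Set Ω, MeasurableSet F →
      Tendsto (fun n => ∑ k ∈ Finset.range n, μs k F) atTop (𝓝 (μ F))) :
    Tendsto (fun n => (μ - ∑ k ∈ Finset.range n, μs k).totalVariation Set.univ)
        atTop (𝓝 0) ∧
    ∀ F : Set Ω, MeasurableSet F →
      μ.totalVariation F = ∑' k, (μs k).totalVariation F := by
  obtain ⟨A, hA, hd, hA₀⟩ := exists_pairwise_disjoint_carriers
    fun k l hkl => (SignedMeasure.mutuallySingular_iff _ _).1 (hsing hkl)
  have hzero {k : ℕ} {t : Set Ω} (ht : t ⊆ (A k)ᶜ) : μs k t = 0 :=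
    (μs k).null_of_totalVariation_zero (measure_mono_null ht (hA₀ k))
  have hrestrict (k : ℕ) : μs k = μ.restrict (A k) := by
    ext F hF
    rw [VectorMeasure.restrict_apply _ (hA k) hF]
    have hk : μs k F = μs k (F ∩ A k) := by
      rw [← VectorMeasure.of_add_of_sdiff (hF.inter (hA k)) hF inter_subset_left,
        hzero (k := k) (t := F \ (F ∩ A k)) (by grind), add_zero]
    refine tendsto_nhds_unique (tendsto_const_nhds.congr' ?_) (hsum _ (hF.inter (hA k)))
    filter_upwards [eventually_gt_atTop k] with n hn
    rw [hk, Finset.sum_eq_single k]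
    · intro l _ hl
      exact hzero (inter_subset_right.trans (hd hl).subset_compl_left)
    · simp [hn]
  have hU : MeasurableSet (⋃ k, A k) := .iUnion hA
  have hnull : μ.totalVariation (⋃ k, A k)ᶜ = 0 := by
    rw [SignedMeasure.totalVariation_eq_variation,
      VectorMeasure.variation_apply_eq_zero hU.compl]
    refine fun t ht hmt => tendsto_nhds_unique (hsum t hmt) (tendsto_const_nhds.congr fun n => ?_)
    exact (Finset.sum_eq_zero fun k _ =>
      hzero (ht.trans (compl_subset_compl.2 (subset_iUnion A k)))).symm
  refine ⟨?_, fun F hF => ?_⟩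
  · have hB (n : ℕ) : MeasurableSet (⋃ k ∈ Finset.range n, A k) :=
      Finset.measurableSet_biUnion _ fun k _ => hA k
    have htail (n : ℕ) : (μ - ∑ k ∈ Finset.range n, μs k).totalVariation univ =
        μ.totalVariation (⋃ k ∈ Finset.range n, A k)ᶜ := by
      have : μ - ∑ k ∈ Finset.range n, μs k = μ.restrict (⋃ k ∈ Finset.range n, A k)ᶜ := by
        rw [sub_eq_iff_eq_add', Finset.sum_congr rfl fun k _ => hrestrict k,
          ← restrict_biUnion_finset μ hA hd, VectorMeasure.restrict_add_restrict_compl (hB n)]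
      rw [this, totalVariation_restrict μ (hB n).compl, Measure.restrict_apply_univ]
    have hinter : ⋂ n, (⋃ k ∈ Finset.range n, A k)ᶜ = (⋃ k, A k)ᶜ := by
      rw [← compl_iUnion]
      congr 1
      ext x
      simp only [mem_iUnion, Finset.mem_range]
      exact ⟨fun ⟨_, k, _, hx⟩ => ⟨k, hx⟩, fun ⟨k, hx⟩ => ⟨k + 1, k, k.lt_succ_self, hx⟩⟩
    simp only [htail]
    rw [← hnull, ← hinter]
    refine tendsto_measure_iInter_atTop (fun n => (hB n).compl.nullMeasurableSet)
      (fun m n hmn => compl_subset_compl.2 ?_) ⟨0, measure_ne_top _ _⟩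
    exact biUnion_subset_biUnion_left (Finset.range_mono hmn)
  · calc μ.totalVariation F = μ.totalVariation (F ∩ ⋃ k, A k) :=
          (measure_inter_conull hnull).symm
      _ = ∑' k, μ.totalVariation (F ∩ A k) := by
          rw [inter_iUnion]
          exact measure_iUnion (fun k l hkl => (hd hkl).mono inter_subset_right inter_subset_right)
            fun k => hF.inter (hA k)
      _ = ∑' k, (μs k).totalVariation F := by
          refine tsum_congr fun k => ?_
          rw [hrestrict k, totalVariation_restrict μ (hA k), Measure.restrict_apply hF]
end

section
/- Let 𝒫 be pre-Hahn-localizable on (Ω, ℱ) with strictly disjointly supported localization 𝒬 (the supports S_Q are pairwise disjoint), and let H be the Hahn extension of ℱ, i.e. the σ-algebra generated by ℱ together with all sets of the form ⋃_{Q∈𝒬} E_Q where E_Q ∈ ℱ and E_Q ⊆ S_Q. Then for every A ∈ H and every Q ∈ 𝒬 one has A ∩ S_Q ∈ ℱ. -/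
open MeasureTheory Set
open scoped ENNReal

variable {Ω : Type*}

/-- The Hahn extension of the σ-algebra: generated by `ℱ` together with all sets of the
form `⋃_{q ∈ Q} E_q` with `E_q ∈ ℱ` and `E_q ⊆ S q`. -/
def hahnExt [m : MeasurableSpace Ω] (Q : Set (Measure Ω)) (S : Measure Ω → Set Ω) :
    MeasurableSpace Ω :=
  m ⊔ MeasurableSpace.generateFrom
    {A | ∃ E : Measure Ω → Set Ω, (∀ q ∈ Q, MeasurableSet[m] (E q) ∧ E q ⊆ S q) ∧
      A = ⋃ q ∈ Q, E q}

/-- If every set in `C` has measurable trace on the measurable set `s`, then so does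
every set of the σ-algebra generated by adjoining `C`. -/
theorem MeasurableSet.inter_of_sup_generateFrom {m : MeasurableSpace Ω} {C : Set (Set Ω)}
    {s : Set Ω} (hs : MeasurableSet[m] s) (hC : ∀ A ∈ C, MeasurableSet[m] (A ∩ s)) {A : Set Ω}
    (hA : MeasurableSet[m ⊔ MeasurableSpace.generateFrom C] A) : MeasurableSet[m] (A ∩ s) := by
  have ht : ∀ B, MeasurableSet[(m.comap (Subtype.val : s → Ω)).map Subtype.val] B ↔
      MeasurableSet[m] (B ∩ s) := fun B => by
    change MeasurableSet (Subtype.val ⁻¹' B : Set s) ↔ _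
    rw [← (MeasurableEmbedding.subtype_coe hs).measurableSet_image,
      Subtype.image_preimage_coe, inter_comm]
  have hle : m ⊔ MeasurableSpace.generateFrom C ≤
      (m.comap (Subtype.val : s → Ω)).map Subtype.val :=
    sup_le (fun B hB => (ht B).2 (hB.inter hs))
      (MeasurableSpace.generateFrom_le fun B hB => (ht B).2 (hC B hB))
  exact (ht A).1 (hle A hA)

/-- If `P` is pre-Hahn-localizable with strictly disjointly supported
localization `Q`, then every set of the Hahn extension intersected with any support `S q`
belongs to the original σ-algebra. -/
theorem stmt11 [m : MeasurableSpace Ω] (P Q : Set (Measure Ω)) (S : Measure Ω → Set Ω)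
    (hpre : IsPreHahnLoc P Q S)
    (hdisj : ∀ q ∈ Q, ∀ r ∈ Q, q ≠ r → Disjoint (S q) (S r)) :
    ∀ A : Set Ω, MeasurableSet[hahnExt Q S] A → ∀ q ∈ Q, MeasurableSet[m] (A ∩ S q) := by
  intro A hA q hq
  refine MeasurableSet.inter_of_sup_generateFrom (hpre.measS q hq) ?_ hA
  rintro _ ⟨E, hE, rfl⟩
  have htrace : (⋃ r ∈ Q, E r) ∩ S q = E q := by
    refine Subset.antisymm ?_ fun x hx => ⟨mem_biUnion hq hx, (hE q hq).2 hx⟩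
    rintro x ⟨hx, hxq⟩
    obtain ⟨r, hr, hxr⟩ := mem_iUnion₂.1 hx
    by_cases h : r = q
    · exact h ▸ hxr
    · exact ((hdisj r hr q hq h).le_bot ⟨(hE r hr).2 hxr, hxq⟩).elim
  rw [htrace]
  exact (hE q hq).1
end

section
/- Let 𝒫 be pre-Hahn-localizable on (Ω, ℱ) with strictly disjointly supported localization 𝒬 (supports S_Q pairwise disjoint), and let H be the Hahn extension of ℱ. Then every μ ∈ ca(𝒫) extends to H: there exists a finite signed measure ν on (Ω, H) such that for every A ∈ H, ν(A) = ∑_{Q∈𝒬(μ)} μ(A ∩ S_Q) (the sum over the at most countable set 𝒬(μ), being absolutely convergent), the total variation satisfies |ν|(A) = ∑_{Q∈𝒬(μ)} |μ|(A ∩ S_Q) for every A ∈ H, and in particular ν(F) = μ(F) and |ν|(F) = |μ|(F) for every F ∈ ℱ, so that ‖ν‖_TV = ‖μ‖_TV. -/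
open MeasureTheory Set
open scoped ENNReal

variable {Ω : Type*}

/-- Application of a measure w.r.t. an explicitly given σ-algebra. -/
def mApply (m' : MeasurableSpace Ω) (ρ : @Measure Ω m') : Set Ω → ℝ≥0∞ := fun A => ρ A

/-- Application of a signed measure w.r.t. an explicitly given σ-algebra. -/
noncomputable def smApply (m' : MeasurableSpace Ω) (ν : @SignedMeasure Ω m') : Set Ω → ℝ :=
  fun A => ν A

/-- Total variation measure of a signed measure w.r.t. an explicitly given σ-algebra. -/
noncomputable def tvM (m' : MeasurableSpace Ω) (ν : @SignedMeasure Ω m') : @Measure Ω m' :=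
  @SignedMeasure.totalVariation Ω m' ν

/-- The sets of the Hahn extension have `ℱ`-measurable traces on the pairwise disjoint supports. -/
theorem measurableSet_inter_of_hahnExt [m : MeasurableSpace Ω] {Q : Set (Measure Ω)}
    {S : Measure Ω → Set Ω} (hS : ∀ q ∈ Q, MeasurableSet (S q))
    (hdisj : ∀ q ∈ Q, ∀ r ∈ Q, q ≠ r → Disjoint (S q) (S r))
    {A : Set Ω} (hA : MeasurableSet[hahnExt Q S] A) {q : Measure Ω} (hq : q ∈ Q) :
    MeasurableSet (A ∩ S q) := by
  have hle : hahnExt Q S ≤ (m.comap ((↑) : S q → Ω)).map ((↑) : S q → Ω) := by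
    refine sup_le (MeasurableSpace.le_map_comap) (MeasurableSpace.generateFrom_le ?_)
    rintro _ ⟨E, hE, rfl⟩
    refine ⟨E q, (hE q hq).1, ?_⟩
    ext ⟨x, hx⟩
    simp only [mem_preimage, mem_iUnion, exists_prop]
    refine ⟨fun h => ⟨q, hq, h⟩, ?_⟩
    rintro ⟨r, hr, hxr⟩
    rcases eq_or_ne q r with rfl | hne
    · exact hxr
    · exact ((hdisj q hq r hr hne).le_bot ⟨hx, (hE r hr).2 hxr⟩).elim
  obtain ⟨B, hB, hBA⟩ := hle A hA
  rw [Subtype.preimage_coe_eq_preimage_coe_iff] at hBA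
  rw [inter_comm, ← hBA]
  exact (hS q hq).inter hB

/-- If a measure is carried by a set `T` on which the σ-algebra `m'` has measurable traces, then
the identity is almost everywhere measurable from the original σ-algebra to `m'`. -/
theorem aemeasurable_id_of_trace {m' m : MeasurableSpace Ω} {ρ : @Measure Ω m} {T : Set Ω}
    (hT : MeasurableSet[m] T) (hρ : ρ Tᶜ = 0)
    (htr : ∀ A, MeasurableSet[m'] A → MeasurableSet[m] (A ∩ T)) :
    @AEMeasurable Ω Ω m' m id ρ := by
  classical
  rcases isEmpty_or_nonempty Ω with _ | ⟨⟨c⟩⟩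
  · exact ⟨id, fun A _ => by rw [Subsingleton.elim (id ⁻¹' A) ∅]; exact MeasurableSet.empty,
      Filter.EventuallyEq.rfl⟩
  · refine ⟨T.piecewise id fun _ => c, fun A hA => ?_, ?_⟩
    · rw [piecewise_preimage, Set.ite]
      refine (htr A hA).union (MeasurableSet.diff ?_ hT)
      by_cases hc : c ∈ A <;> simp [hc]
    · have hae : ∀ᵐ x ∂ρ, x ∈ T := mem_ae_iff.2 hρ
      filter_upwards [hae] with x hx
      simp [hx]

/-- Under the localization, the total variation of `μ ∈ ca(P)` charges only countably many
supports, and these carry it. -/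
theorem IsPreHahnLoc.countable_and_null [MeasurableSpace Ω] {P Q : Set (Measure Ω)}
    {S : Measure Ω → Set Ω} (hpre : IsPreHahnLoc P Q S) {ρ p : Measure Ω} (hp : p ∈ P)
    (hρ : ρ ≪ p) :
    {q | q ∈ Q ∧ 0 < ρ (S q)}.Countable ∧ ρ (⋃ q : {q // q ∈ Q ∧ 0 < ρ (S q)}, S q.1)ᶜ = 0 := by
  obtain ⟨_, ⟨f, l, hf, -, rfl⟩, hps⟩ := hpre.ps p hp
  have hac := hρ.trans hps
  have hcount : {q | q ∈ Q ∧ 0 < ρ (S q)}.Countable := by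
    refine (countable_range f).mono ?_
    rintro q ⟨hq, hpos⟩
    by_contra hne
    refine hpos.ne' (hac ?_)
    rw [Measure.sum_apply _ (hpre.measS q hq), ENNReal.tsum_eq_zero]
    intro k
    simp [hpre.other (f k) (hf k) q hq fun h => hne ⟨k, h⟩]
  refine ⟨hcount, ?_⟩
  have hcarry : ρ (⋃ k, S (f k))ᶜ = 0 := by
    refine hac ?_
    rw [Measure.sum_apply _ (MeasurableSet.iUnion fun k => hpre.measS _ (hf k)).compl,
      ENNReal.tsum_eq_zero]
    intro k
    have := hpre.probQ _ (hf k)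
    have hk : f k (⋃ k, S (f k))ᶜ = 0 := measure_mono_null
      (compl_subset_compl.2 (subset_iUnion (fun k => S (f k)) k))
      ((prob_compl_eq_zero_iff (hpre.measS _ (hf k))).2 (hpre.self _ (hf k)))
    rw [Measure.smul_apply, hk, smul_zero]
  have hnull : ρ (⋃ k : {k // ρ (S (f k)) = 0}, S (f k)) = 0 := measure_iUnion_null fun k => k.2
  refine measure_mono_null (fun x hx => ?_) (measure_union_null hcarry hnull)
  by_cases hx' : ∃ k, x ∈ S (f k)
  · obtain ⟨k, hk⟩ := hx'
    refine Or.inr (mem_iUnion.2 ⟨⟨k, ?_⟩, hk⟩)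
    by_contra h0
    exact hx (mem_iUnion.2 ⟨⟨f k, hf k, pos_iff_ne_zero.2 h0⟩, hk⟩)
  · exact Or.inl (by simpa using hx')

/-- A signed measure whose total variation makes the identity almost everywhere measurable into a
larger σ-algebra `m'` extends to `m'`, together with its total variation. -/
theorem exists_signedMeasure_extension {m' m : MeasurableSpace Ω} (hle : m ≤ m')
    (μ : @SignedMeasure Ω m) (hid : @AEMeasurable Ω Ω m' m id μ.totalVariation) :
    ∃ ν : @SignedMeasure Ω m', ∀ A, MeasurableSet[m'] A →
      smApply m' ν A = (μ.toJordanDecomposition.posPart A).toReal -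
        (μ.toJordanDecomposition.negPart A).toReal ∧
      mApply m' (tvM m' ν) A = μ.totalVariation A := by
  have hpos : @AEMeasurable Ω Ω m' m id μ.toJordanDecomposition.posPart :=
    @AEMeasurable.mono_measure Ω Ω m m' id _ _ hid (Measure.le_add_right le_rfl)
  have hneg : @AEMeasurable Ω Ω m' m id μ.toJordanDecomposition.negPart :=
    @AEMeasurable.mono_measure Ω Ω m m' id _ _ hid (Measure.le_add_left le_rfl)
  let ρp : @Measure Ω m' := @Measure.map Ω Ω m m' id μ.toJordanDecomposition.posPart
  let ρn : @Measure Ω m' := @Measure.map Ω Ω m m' id μ.toJordanDecomposition.negPart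
  have hp : ∀ A, MeasurableSet[m'] A → ρp A = μ.toJordanDecomposition.posPart A :=
    fun A hA => @Measure.map_apply_of_aemeasurable Ω Ω m m' _ id hpos A hA
  have hn : ∀ A, MeasurableSet[m'] A → ρn A = μ.toJordanDecomposition.negPart A :=
    fun A hA => @Measure.map_apply_of_aemeasurable Ω Ω m m' _ id hneg A hA
  have hfp : @IsFiniteMeasure Ω m' ρp :=
    @Measure.isFiniteMeasure_map Ω Ω m' m μ.toJordanDecomposition.posPart inferInstance id
  have hfn : @IsFiniteMeasure Ω m' ρn :=
    @Measure.isFiniteMeasure_map Ω Ω m' m μ.toJordanDecomposition.negPart inferInstance id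
  obtain ⟨B, hB, hB0, hB1⟩ := μ.toJordanDecomposition.mutuallySingular
  let j : @JordanDecomposition Ω m' :=
    @JordanDecomposition.mk Ω m' ρp ρn hfp hfn
      ⟨B, hle _ hB, (hp _ (hle _ hB)).trans hB0, (hn _ (hle _ hB.compl)).trans hB1⟩
  refine ⟨@JordanDecomposition.toSignedMeasure Ω m' j, fun A hA => ⟨?_, ?_⟩⟩
  · rw [← hp A hA, ← hn A hA]
    simp only [smApply, JordanDecomposition.toSignedMeasure, sub_apply,
      Measure.toSignedMeasure_apply, hA, if_true]
    rfl
  · simp only [mApply, tvM, SignedMeasure.totalVariation,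
      JordanDecomposition.toJordanDecomposition_toSignedMeasure, Measure.add_apply]
    rw [← hp A hA, ← hn A hA]

/-- A signed measure is the difference of its Jordan parts. -/
theorem signedMeasure_apply_eq_jordan_sub [MeasurableSpace Ω] (μ : SignedMeasure Ω) {A : Set Ω}
    (hA : MeasurableSet A) :
    μ A = (μ.toJordanDecomposition.posPart A).toReal -
      (μ.toJordanDecomposition.negPart A).toReal := by
  conv_lhs => rw [← μ.toSignedMeasure_toJordanDecomposition]
  simp [JordanDecomposition.toSignedMeasure, sub_apply,
    Measure.toSignedMeasure_apply, hA, Measure.real]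

/-- Every `μ ∈ ca(P)` extends to a finite signed measure `ν` on the Hahn
extension, given on `H`-measurable sets `A` by the (absolutely convergent) sum
`ν A = ∑_{q ∈ Q(μ)} μ (A ∩ S q)`; the total variation satisfies
`|ν| A = ∑_{q ∈ Q(μ)} |μ| (A ∩ S q)`; in particular `ν` and `|ν|` agree with `μ` and `|μ|`
on `ℱ`, and `‖ν‖_TV = ‖μ‖_TV`. -/
theorem stmt12 [m : MeasurableSpace Ω] (P Q : Set (Measure Ω)) (S : Measure Ω → Set Ω)
    (hpre : IsPreHahnLoc P Q S)
    (hdisj : ∀ q ∈ Q, ∀ r ∈ Q, q ≠ r → Disjoint (S q) (S r))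
    (μ : SignedMeasure Ω) (hμ : ∃ p ∈ P, μ.totalVariation ≪ p) :
    ∃ ν : @SignedMeasure Ω (hahnExt Q S),
      (∀ A : Set Ω, MeasurableSet[hahnExt Q S] A →
        Summable (fun q : {q // q ∈ Q ∧ 0 < μ.totalVariation (S q)} => |μ (A ∩ S q.1)|) ∧
        smApply (hahnExt Q S) ν A =
          ∑' q : {q // q ∈ Q ∧ 0 < μ.totalVariation (S q)}, μ (A ∩ S q.1)) ∧
      (∀ A : Set Ω, MeasurableSet[hahnExt Q S] A →
        mApply (hahnExt Q S) (tvM (hahnExt Q S) ν) A =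
          ∑' q : {q // q ∈ Q ∧ 0 < μ.totalVariation (S q)}, μ.totalVariation (A ∩ S q.1)) ∧
      (∀ F : Set Ω, MeasurableSet[m] F →
        smApply (hahnExt Q S) ν F = μ F ∧
        mApply (hahnExt Q S) (tvM (hahnExt Q S) ν) F = μ.totalVariation F) ∧
      mApply (hahnExt Q S) (tvM (hahnExt Q S) ν) Set.univ = μ.totalVariation Set.univ := by
  obtain ⟨p, hp, hμp⟩ := hμ
  obtain ⟨hcount, hnull⟩ := hpre.countable_and_null hp hμp
  have : Countable {q // q ∈ Q ∧ 0 < μ.totalVariation (S q)} := hcount.to_subtype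
  set T : Set Ω := ⋃ q : {q // q ∈ Q ∧ 0 < μ.totalVariation (S q)}, S q.1
  have hT : MeasurableSet[m] T := MeasurableSet.iUnion fun q => hpre.measS _ q.2.1
  have htr : ∀ A, MeasurableSet[hahnExt Q S] A →
      ∀ q : {q // q ∈ Q ∧ 0 < μ.totalVariation (S q)}, MeasurableSet[m] (A ∩ S q.1) :=
    fun A hA q => measurableSet_inter_of_hahnExt hpre.measS hdisj hA q.2.1
  have htrT : ∀ A, MeasurableSet[hahnExt Q S] A → MeasurableSet[m] (A ∩ T) := fun A hA => by
    rw [inter_iUnion]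
    exact MeasurableSet.iUnion (htr A hA)
  have hpw : ∀ A : Set Ω, Pairwise (Function.onFun Disjoint
      fun q : {q // q ∈ Q ∧ 0 < μ.totalVariation (S q)} => A ∩ S q.1) := fun A q r hqr =>
    (hdisj _ q.2.1 _ r.2.1 fun h => hqr (Subtype.ext h)).mono inter_subset_right inter_subset_right
  have hle : m ≤ hahnExt Q S := le_sup_left
  obtain ⟨ν, hν⟩ := exists_signedMeasure_extension hle μ (aemeasurable_id_of_trace hT hnull htrT)
  have hnull' : μ.toJordanDecomposition.posPart Tᶜ = 0 ∧
      μ.toJordanDecomposition.negPart Tᶜ = 0 := by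
    simpa [SignedMeasure.totalVariation] using hnull
  refine ⟨ν, fun A hA => ?_, fun A hA => ?_, fun F hF => ?_, (hν _ MeasurableSet.univ).2⟩
  · have hsum := VectorMeasure.hasSum_of_disjoint_iUnion (v := μ) (htr A hA) (hpw A)
    rw [← inter_iUnion] at hsum
    refine ⟨summable_abs_iff.2 hsum.summable, ?_⟩
    rw [hsum.tsum_eq, (hν A hA).1, signedMeasure_apply_eq_jordan_sub μ (htrT A hA),
      measure_inter_conull hnull'.1, measure_inter_conull hnull'.2]
  · rw [(hν A hA).2, ← measure_iUnion (hpw A) (htr A hA), ← inter_iUnion,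
      measure_inter_conull hnull]
  · refine ⟨?_, (hν F (hle F hF)).2⟩
    rw [(hν F (hle F hF)).1, signedMeasure_apply_eq_jordan_sub μ hF]
end

section
/- Let 𝒫 be pre-Hahn-localizable on (Ω, ℱ) with strictly disjointly supported localization 𝒬 (supports S_Q pairwise disjoint), and let H be the Hahn extension of ℱ. For μ ∈ ca(𝒫) and P ∈ 𝒫, let μ^𝒬 and P^𝒬 denote their extensions to H, given by μ^𝒬(A) = ∑_{Q∈𝒬(μ)} μ(A ∩ S_Q) and P^𝒬(A) = ∑_{Q∈𝒬(P)} P(A ∩ S_Q) for A ∈ H. Then |μ| ≪ P (on ℱ) if and only if |μ^𝒬| ≪ P^𝒬 (on H). -/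
open MeasureTheory Set
open scoped ENNReal

variable {Ω : Type*}

theorem signedMeasure_totalVariation_absolutelyContinuous_iff_forall {m : MeasurableSpace Ω}
    (s : SignedMeasure Ω) (ρ : Measure Ω) :
    s.totalVariation ≪ ρ ↔ ∀ A, MeasurableSet A → ρ A = 0 → s A = 0 := by
  have h := s.absolutelyContinuous_ennreal_iff ρ.toENNRealVectorMeasure
  rw [VectorMeasure.ennrealToMeasure_toENNRealVectorMeasure] at h
  rw [← h]
  constructor
  · intro h A hA hρ
    exact h (by rwa [Measure.toENNRealVectorMeasure_apply_measurable hA])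
  · intro h
    refine VectorMeasure.AbsolutelyContinuous.mk fun A hA hρ => h A hA ?_
    rwa [Measure.toENNRealVectorMeasure_apply_measurable hA] at hρ

/-- A measure dominated by an element of `P` charges only countably many supports, and is
concentrated on their union. -/
theorem IsPreHahnLoc.countable_and_measure_compl_eq_zero [MeasurableSpace Ω]
    {P Q : Set (Measure Ω)} {S : Measure Ω → Set Ω} (hpre : IsPreHahnLoc P Q S)
    {p ρ : Measure Ω} (hp : p ∈ P) (hρ : ρ ≪ p) :
    {q | q ∈ Q ∧ 0 < ρ (S q)}.Countable ∧
      ρ (⋃ q ∈ {q | q ∈ Q ∧ 0 < ρ (S q)}, S q)ᶜ = 0 := by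
  obtain ⟨_, ⟨f, l, hf, -, rfl⟩, hpσ⟩ := hpre.ps p hp
  have hnull : ∀ A, (∀ k, f k A = 0) → ρ A = 0 := fun A hA =>
    hρ (hpσ (Measure.sum_apply_eq_zero.2 fun k => by simp [hA k]))
  refine ⟨(countable_range f).mono ?_, ?_⟩
  · rintro q ⟨hq, hpos⟩
    by_contra hqf
    exact hpos.ne' (hnull _ fun k => hpre.other _ (hf k) _ hq fun h => hqf ⟨k, h⟩)
  · have hunion : ρ (⋃ k, S (f k))ᶜ = 0 := hnull _ fun k => by
      have := hpre.probQ _ (hf k)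
      exact measure_mono_null (compl_subset_compl.2 (subset_iUnion (fun k => S (f k)) k))
        ((prob_compl_eq_zero_iff (hpre.measS _ (hf k))).2 (hpre.self _ (hf k)))
    have hrest : ρ (⋃ k ∈ {k | ρ (S (f k)) = 0}, S (f k)) = 0 :=
      (measure_biUnion_null_iff (to_countable _)).2 fun k hk => hk
    refine measure_mono_null (fun x hx => ?_) (measure_union_null hunion hrest)
    by_cases hxf : x ∈ ⋃ k, S (f k)
    · obtain ⟨k, hk⟩ := mem_iUnion.1 hxf
      refine Or.inr (mem_biUnion (x := k) ?_ hk)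
      by_contra h0
      exact hx (mem_biUnion (x := f k) ⟨hf k, pos_iff_ne_zero.2 h0⟩ hk)
    · exact Or.inl hxf

/-- Let `ν` and `p'` be the extensions of `μ ∈ ca(P)` and `p ∈ P` to the
Hahn extension `H`, determined by `ν A = ∑_{q ∈ Q(μ)} μ (A ∩ S q)` and
`p' A = ∑_{q ∈ Q(p)} p (A ∩ S q)` for `A ∈ H`. Then `|μ| ≪ p` (on `ℱ`) iff `|ν| ≪ p'`
(on `H`). -/
theorem stmt13 [m : MeasurableSpace Ω] (P Q : Set (Measure Ω)) (S : Measure Ω → Set Ω)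
    (hpre : IsPreHahnLoc P Q S)
    (hdisj : ∀ q ∈ Q, ∀ r ∈ Q, q ≠ r → Disjoint (S q) (S r))
    (μ : SignedMeasure Ω) (hμ : ∃ p₀ ∈ P, μ.totalVariation ≪ p₀)
    (p : Measure Ω) (hp : p ∈ P)
    (ν : @SignedMeasure Ω (hahnExt Q S))
    (hν : ∀ A : Set Ω, MeasurableSet[hahnExt Q S] A →
      smApply (hahnExt Q S) ν A =
        ∑' q : {q // q ∈ Q ∧ 0 < μ.totalVariation (S q)}, μ (A ∩ S q.1))
    (p' : @Measure Ω (hahnExt Q S))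
    (hp' : ∀ A : Set Ω, MeasurableSet[hahnExt Q S] A →
      mApply (hahnExt Q S) p' A = ∑' q : {q // q ∈ Q ∧ 0 < p (S q)}, p (A ∩ S q.1)) :
    μ.totalVariation ≪ p ↔ tvM (hahnExt Q S) ν ≪ p' := by
  have hmeas {A : Set Ω} (hA : MeasurableSet[hahnExt Q S] A) {q : Measure Ω} (hq : q ∈ Q) :
      MeasurableSet (A ∩ S q) := measurableSet_inter_of_hahnExt hpre.measS hdisj hA hq
  obtain ⟨p₀, hp₀, hμp₀⟩ := hμ
  obtain ⟨hcount, hcompl⟩ := hpre.countable_and_measure_compl_eq_zero hp₀ hμp₀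
  have := hcount.to_subtype
  refine (signedMeasure_totalVariation_absolutelyContinuous_iff_forall μ p).trans
    (Iff.trans ?_
      (signedMeasure_totalVariation_absolutelyContinuous_iff_forall (m := hahnExt Q S) ν p').symm)
  constructor
  · intro h A hA hp'A
    have hsum : ∑' q : {q // q ∈ Q ∧ 0 < p (S q)}, p (A ∩ S q.1) = 0 := (hp' A hA).symm.trans hp'A
    refine (hν A hA).trans ((tsum_congr fun q => ?_).trans tsum_zero)
    refine h _ (hmeas hA q.2.1) ?_
    by_cases hq : 0 < p (S q.1)
    · exact ENNReal.tsum_eq_zero.1 hsum ⟨q.1, q.2.1, hq⟩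
    · exact measure_mono_null inter_subset_right (nonpos_iff_eq_zero.1 (not_lt.1 hq))
  · intro h A hA hpA
    have hAH : MeasurableSet[hahnExt Q S] A := (le_sup_left : m ≤ hahnExt Q S) A hA
    have hνA : ∑' q : {q // q ∈ Q ∧ 0 < μ.totalVariation (S q)}, μ (A ∩ S q.1) = 0 := by
      refine (hν A hAH).symm.trans (h A hAH ((hp' A hAH).trans ?_))
      exact ENNReal.tsum_eq_zero.2 fun q => measure_mono_null inter_subset_left hpA
    set T := ⋃ q ∈ {q | q ∈ Q ∧ 0 < μ.totalVariation (S q)}, S q with hT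
    have hTm : MeasurableSet T := MeasurableSet.biUnion hcount fun q hq => hpre.measS q hq.1
    have hdiff : μ (A \ T) = 0 := μ.null_of_totalVariation_zero
      (measure_mono_null (fun x hx => hx.2) hcompl)
    have hinter : μ (A ∩ T) = 0 := by
      rw [← hνA, hT, biUnion_eq_iUnion, inter_iUnion]
      refine μ.of_disjoint_iUnion (fun q => hA.inter (hpre.measS _ q.2.1)) fun q r hqr => ?_
      exact (hdisj _ q.2.1 _ r.2.1 (Subtype.coe_ne_coe.2 hqr)).mono inter_subset_right
        inter_subset_right
    rw [← inter_union_sdiff A T, VectorMeasure.of_union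
      (disjoint_sdiff_right.mono_left inter_subset_right) (hA.inter hTm) (hA.diff hTm),
      hinter, hdiff, add_zero]
end

section
/- Let (Ω, ℱ) be a measurable space and 𝒫 a convex family of probability measures on ℱ. Assume there is a σ-finite measure λ on ℱ and a subfamily 𝒬 ⊆ 𝒫 such that: (1) there are pairwise disjoint sets S_Q ∈ ℱ with R(S_Q) = 1 if R = Q and R(S_Q) = 0 if R ≠ Q, for all Q, R ∈ 𝒬; (2) λ is mutually singular to every Q ∈ 𝒬; (3) every P ∈ 𝒫 can be written as P = P_λ + P_𝒬 where P_λ ≪ λ and P_𝒬 ≪ ∑_{k≥1} λ_k Q_k for some λ_k ≥ 0 with ∑_k λ_k = 1 and Q_k ∈ 𝒬. Then every μ ∈ ca(𝒫) can be written as μ = μ_λ + μ_𝒬 where |μ_λ| ≪ λ and |μ_𝒬| ≪ Q* for some Q* ∈ sconv(𝒬). -/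
open MeasureTheory Set
open scoped ENNReal

variable {Ω : Type*}

/-- If `p = pl + pq` with `pl ≪ lam` and `pq ≪ R`, and `A` is a `lam`-null measurable set, then
the restriction to `A` of a signed measure dominated by `p` is dominated by `R`. -/
lemma MeasureTheory.SignedMeasure.totalVariation_restrict_absolutelyContinuous
    [MeasurableSpace Ω] {μ : SignedMeasure Ω} {pl pq lam R : Measure Ω}
    (hμ : μ.totalVariation ≪ pl + pq) (hl : pl ≪ lam) (hq : pq ≪ R)
    {A : Set Ω} (hA : MeasurableSet A) (hA0 : lam A = 0) :
    SignedMeasure.totalVariation (μ.restrict A) ≪ R := by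
  have key : μ.restrict A ≪ᵥ R.toENNRealVectorMeasure := by
    refine VectorMeasure.AbsolutelyContinuous.mk fun B hB hRB => ?_
    rw [Measure.toENNRealVectorMeasure_apply_measurable hB] at hRB
    rw [VectorMeasure.restrict_apply _ hA hB]
    apply SignedMeasure.null_of_totalVariation_zero
    apply hμ
    rw [Measure.add_apply, measure_mono_null inter_subset_right (hl hA0),
      measure_mono_null inter_subset_left (hq hRB), add_zero]
  rwa [SignedMeasure.absolutelyContinuous_ennreal_iff,
    VectorMeasure.ennrealToMeasure_toENNRealVectorMeasure] at key

/-- A measure singular to every member of `Q` is singular to every member of `sconv Q`. -/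
lemma mutuallySingular_of_mem_sconv [MeasurableSpace Ω] {Q : Set (Measure Ω)}
    {lam R : Measure Ω} (h : ∀ q ∈ Q, lam ⟂ₘ q) (hR : R ∈ sconv Q) : lam ⟂ₘ R := by
  obtain ⟨f, l, hf, -, rfl⟩ := hR
  exact Measure.MutuallySingular.sum_right.2 fun k => ((h _ (hf k)).symm.smul (l k)).symm

/-- Let `P` be a convex family of probability measures, `lam` a σ-finite
measure, and `Q ⊆ P` a disjointly supported subfamily singular to `lam`, such that every
`p ∈ P` decomposes as `p = p_lam + p_Q` with `p_lam ≪ lam` and `p_Q ≪ R` for some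
`R ∈ sconv Q`. Then every `μ ∈ ca(P)` decomposes as `μ = μ_lam + μ_Q` with
`|μ_lam| ≪ lam` and `|μ_Q| ≪ Q*` for some `Q* ∈ sconv Q`. -/
theorem stmt15 [MeasurableSpace Ω] (P : Set (Measure Ω))
    (hP : ∀ p ∈ P, IsProbabilityMeasure p)
    (hconvex : ∀ p ∈ P, ∀ q ∈ P, ∀ t : ℝ≥0∞, t ≤ 1 → t • p + (1 - t) • q ∈ P)
    (lam : Measure Ω) (hlam : SigmaFinite lam)
    (Q : Set (Measure Ω)) (hQP : Q ⊆ P)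
    (S : Measure Ω → Set Ω)
    (hSm : ∀ q ∈ Q, MeasurableSet (S q))
    (hdisj : ∀ q ∈ Q, ∀ r ∈ Q, q ≠ r → Disjoint (S q) (S r))
    (hself : ∀ q ∈ Q, q (S q) = 1)
    (hother : ∀ q ∈ Q, ∀ r ∈ Q, q ≠ r → r (S q) = 0)
    (hsing : ∀ q ∈ Q, lam ⟂ₘ q)
    (hdec : ∀ p ∈ P, ∃ pl pq : Measure Ω, p = pl + pq ∧ pl ≪ lam ∧
      ∃ R ∈ sconv Q, pq ≪ R) :
    ∀ μ : SignedMeasure Ω, (∃ p ∈ P, μ.totalVariation ≪ p) →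
      ∃ μl μq : SignedMeasure Ω, μ = μl + μq ∧ μl.totalVariation ≪ lam ∧
        ∃ R ∈ sconv Q, μq.totalVariation ≪ R := by
  rintro μ ⟨p, hp, hμ⟩
  obtain ⟨pl, pq, rfl, hl, R, hR, hq⟩ := hdec p hp
  obtain ⟨A, hA, hA0, hAc⟩ := mutuallySingular_of_mem_sconv hsing hR
  refine ⟨μ.restrict Aᶜ, μ.restrict A, ?_, ?_, R, hR, ?_⟩
  · rw [add_comm, VectorMeasure.restrict_add_restrict_compl hA]
  · rw [add_comm] at hμ
    exact μ.totalVariation_restrict_absolutelyContinuous hμ hq hl hA.compl hAc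
  · exact μ.totalVariation_restrict_absolutelyContinuous hμ hl hq hA hA0
end

section
/- Let u₀, U₀, d₀, D₀, π₀, Π₀ ∈ ℝ satisfy 0 < π₀ ≤ Π₀ < 1, d₀ ≤ D₀, u₀ ≤ U₀, 0 < d₀ < 1 < U₀, d₀ < min(u₀, D₀) and max(u₀, D₀) < U₀. Set m₀ = min(u₀, D₀), M₀ = max(u₀, D₀), π̃ = (π₀+Π₀)/2, and let f : [d₀, m₀] → [M₀, U₀] be continuous and strictly decreasing with f(d₀) = U₀ and f(m₀) = M₀. On Ω = (0, ∞) with the Borel σ-algebra, define ℛ = {π δ_u + (1−π) δ_d : u ∈ [u₀, U₀], d ∈ [d₀, D₀], π ∈ [π₀, Π₀]} and ℛ̃ = {π̃ δ_{f(d)} + (1−π̃) δ_d : d ∈ [d₀, m₀)} ∪ {δ_a : a ∈ [d₀, D₀] ∩ [u₀, U₀]} ∪ {π̃ δ_{f(d)} + (1−π̃) δ_d : d ∈ [m₀, D₀] ∩ [D₀, M₀)}. Then: (i) ℛ̃ ⊆ ℛ; (ii) any two distinct measures R₁ ≠ R₂ in ℛ̃ have disjoint supports, where the support of π̃ δ_{f(d)}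 + (1−π̃) δ_d is {d, f(d)} and the support of δ_a is {a}; (iii) ℛ̃ and ℛ have the same polar sets: for every Borel set A ⊆ (0, ∞), R(A) = 0 for all R ∈ ℛ̃ if and only if R(A) = 0 for all R ∈ ℛ. -/
open MeasureTheory Set
open scoped ENNReal

/-- The uncertainty set `ℛ` of the robust one-step binomial model: all laws
`π δ_u + (1−π) δ_d` with parameters in `E₀ = [u₀,U₀] × [d₀,D₀] × [π₀,π₁]`. -/
noncomputable def binR (u₀ U₀ d₀ D₀ π₀ π₁ : ℝ) : Set (Measure ℝ) :=
  {ρ | ∃ u ∈ Icc u₀ U₀, ∃ d ∈ Icc d₀ D₀, ∃ p ∈ Icc π₀ π₁,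
    ρ = ENNReal.ofReal p • Measure.dirac u + ENNReal.ofReal (1 - p) • Measure.dirac d}

/-- The strictly disjointly supported alternative `ℛ̃`, built from a strictly decreasing
parametrization `f : [d₀, m₀] → [M₀, U₀]` (with `m₀ = min u₀ D₀`, `M₀ = max u₀ D₀`) and the
fixed probability `π̃ = (π₀+π₁)/2`. -/
noncomputable def binRt (u₀ U₀ d₀ D₀ π₀ π₁ : ℝ) (f : ℝ → ℝ) : Set (Measure ℝ) :=
  {ρ | ∃ d ∈ Ico d₀ (min u₀ D₀),
      ρ = ENNReal.ofReal ((π₀ + π₁) / 2) • Measure.dirac (f d)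
        + ENNReal.ofReal (1 - (π₀ + π₁) / 2) • Measure.dirac d} ∪
  {ρ | ∃ a ∈ Icc d₀ D₀ ∩ Icc u₀ U₀, ρ = Measure.dirac a} ∪
  {ρ | ∃ d ∈ Icc (min u₀ D₀) D₀ ∩ Ico D₀ (max u₀ D₀),
      ρ = ENNReal.ofReal ((π₀ + π₁) / 2) • Measure.dirac (f d)
        + ENNReal.ofReal (1 - (π₀ + π₁) / 2) • Measure.dirac d}

/-- A two-point law with both weights positive charges exactly the sets meeting its atoms. -/
theorem mix_dirac_apply_eq_zero {p u d : ℝ} (hp0 : 0 < p) (hp1 : p < 1) {A : Set ℝ}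
    (hA : MeasurableSet A) :
    (ENNReal.ofReal p • Measure.dirac u + ENNReal.ofReal (1 - p) • Measure.dirac d) A = 0 ↔
      u ∉ A ∧ d ∉ A := by
  simp [hA, hp0.not_ge, hp1.not_ge]

theorem mix_dirac_self {p a : ℝ} (hp0 : 0 ≤ p) (hp1 : p ≤ 1) :
    ENNReal.ofReal p • Measure.dirac a + ENNReal.ofReal (1 - p) • Measure.dirac a =
      Measure.dirac a := by
  rw [← add_smul, ← ENNReal.ofReal_add hp0 (by linarith)]
  simp

theorem atoms_mix_dirac {p u d : ℝ} (hp0 : 0 < p) (hp1 : p < 1) :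
    {x : ℝ | (ENNReal.ofReal p • Measure.dirac u + ENNReal.ofReal (1 - p) • Measure.dirac d) {x}
      ≠ 0} = {u, d} := by
  ext x
  rw [mem_ofPred_eq, Ne, mix_dirac_apply_eq_zero hp0 hp1 (measurableSet_singleton x)]
  simp only [mem_singleton_iff, mem_insert_iff, eq_comm (a := x)]
  tauto

theorem atoms_dirac (a : ℝ) : {x : ℝ | Measure.dirac a {x} ≠ 0} = {a} := by
  ext x
  simp [Set.indicator_apply, eq_comm]

/-- The three families making up `ℛ̃`, rearranged as two-point laws on the graph of `f` and Dirac
measures on the overlap `[u₀, D₀]`. -/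
theorem mem_binRt_iff {u₀ U₀ d₀ D₀ π₀ π₁ : ℝ} {f : ℝ → ℝ} (h9 : d₀ < min u₀ D₀)
    (h10 : max u₀ D₀ < U₀) {ρ : Measure ℝ} :
    ρ ∈ binRt u₀ U₀ d₀ D₀ π₀ π₁ f ↔
      (∃ d ∈ Icc d₀ (min u₀ D₀), (d < min u₀ D₀ ∨ D₀ < u₀) ∧
        ρ = ENNReal.ofReal ((π₀ + π₁) / 2) • Measure.dirac (f d)
          + ENNReal.ofReal (1 - (π₀ + π₁) / 2) • Measure.dirac d) ∨
      ∃ a ∈ Icc u₀ D₀, ρ = Measure.dirac a := by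
  have hd : d₀ < u₀ ∧ d₀ < D₀ := lt_min_iff.1 h9
  have hU : u₀ < U₀ ∧ D₀ < U₀ := max_lt_iff.1 h10
  constructor
  · rintro ((⟨d, hd', rfl⟩ | ⟨a, ha, rfl⟩) | ⟨d, hd', rfl⟩)
    · exact Or.inl ⟨d, ⟨hd'.1, hd'.2.le⟩, Or.inl hd'.2, rfl⟩
    · exact Or.inr ⟨a, ⟨ha.2.1, ha.1.2⟩, rfl⟩
    · obtain ⟨⟨-, hle⟩, hge, hlt⟩ := hd'
      obtain rfl : d = D₀ := le_antisymm hle hge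
      have hu : d < u₀ := by simpa using hlt
      exact Or.inl ⟨d, ⟨hd.2.le, le_min hu.le le_rfl⟩, Or.inr hu, rfl⟩
  · rintro (⟨d, hd', h | h, rfl⟩ | ⟨a, ha, rfl⟩)
    · exact Or.inl (Or.inl ⟨d, ⟨hd'.1, h⟩, rfl⟩)
    · rcases hd'.2.lt_or_eq with h' | h'
      · exact Or.inl (Or.inl ⟨d, ⟨hd'.1, h'⟩, rfl⟩)
      · have hD : d = D₀ := h'.trans (min_eq_right h.le)
        exact Or.inr ⟨d, ⟨⟨h'.ge, hD.le⟩, hD.ge, hD.trans_lt (lt_max_of_lt_left h)⟩, rfl⟩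
    · exact Or.inl (Or.inr ⟨a, ⟨⟨hd.1.le.trans ha.1, ha.2⟩, ha.1, ha.2.trans hU.2.le⟩, rfl⟩)

/-- Under the assumptions of the robust one-step binomial model, the family
`ℛ̃` is contained in `ℛ`, has pairwise disjoint supports (the supports being the sets of
atoms), and has the same polar sets as `ℛ`. -/
theorem stmt17 (u₀ U₀ d₀ D₀ π₀ π₁ : ℝ)
    (h1 : 0 < π₀) (h2 : π₀ ≤ π₁) (h3 : π₁ < 1)
    (h4 : d₀ ≤ D₀) (h5 : u₀ ≤ U₀)
    (h6 : 0 < d₀) (h7 : d₀ < 1) (h8 : 1 < U₀)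
    (h9 : d₀ < min u₀ D₀) (h10 : max u₀ D₀ < U₀)
    (f : ℝ → ℝ)
    (hfanti : StrictAntiOn f (Icc d₀ (min u₀ D₀)))
    (hfcont : ContinuousOn f (Icc d₀ (min u₀ D₀)))
    (hfmaps : MapsTo f (Icc d₀ (min u₀ D₀)) (Icc (max u₀ D₀) U₀))
    (hfd : f d₀ = U₀) (hfm : f (min u₀ D₀) = max u₀ D₀) :
    binRt u₀ U₀ d₀ D₀ π₀ π₁ f ⊆ binR u₀ U₀ d₀ D₀ π₀ π₁ ∧
    (∀ ρ₁ ∈ binRt u₀ U₀ d₀ D₀ π₀ π₁ f, ∀ ρ₂ ∈ binRt u₀ U₀ d₀ D₀ π₀ π₁ f, ρ₁ ≠ ρ₂ →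
      Disjoint {x : ℝ | ρ₁ {x} ≠ 0} {x : ℝ | ρ₂ {x} ≠ 0}) ∧
    (∀ A : Set ℝ, A ⊆ Set.Ioi (0:ℝ) → MeasurableSet A →
      ((∀ ρ ∈ binRt u₀ U₀ d₀ D₀ π₀ π₁ f, ρ A = 0) ↔
        ∀ ρ ∈ binR u₀ U₀ d₀ D₀ π₀ π₁, ρ A = 0)) := by
  have hp0 : 0 < (π₀ + π₁) / 2 := by linarith
  have hp1 : (π₀ + π₁) / 2 < 1 := by linarith
  have hpm : (π₀ + π₁) / 2 ∈ Icc π₀ π₁ := ⟨by linarith, by linarith⟩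
  have hsub : binRt u₀ U₀ d₀ D₀ π₀ π₁ f ⊆ binR u₀ U₀ d₀ D₀ π₀ π₁ := by
    intro ρ hρ
    rcases (mem_binRt_iff h9 h10).1 hρ with ⟨d, hd, -, rfl⟩ | ⟨a, ha, rfl⟩
    · have hf := hfmaps hd
      exact ⟨f d, ⟨(le_max_left _ _).trans hf.1, hf.2⟩, d,
        ⟨hd.1, hd.2.trans (min_le_right _ _)⟩, _, hpm, rfl⟩
    · exact ⟨a, ⟨ha.1, ha.2.trans ((le_max_right _ _).trans h10.le)⟩, a,
        ⟨(h9.le.trans (min_le_left _ _)).trans ha.1, ha.2⟩, _, hpm,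
        (mix_dirac_self hp0.le hp1.le).symm⟩
  have hbelow : ∀ d, d < min u₀ D₀ ∨ D₀ < u₀ → d ∈ Icc d₀ (min u₀ D₀) → d < u₀ := by
    rintro d (h | h) hd
    · exact h.trans_le (min_le_left _ _)
    · exact (hd.2.trans (min_le_right _ _)).trans_lt h
  have habove : ∀ d, d < min u₀ D₀ ∨ D₀ < u₀ → d ∈ Icc d₀ (min u₀ D₀) → D₀ < f d := by
    rintro d (h | h) hd
    · have := hfanti hd (right_mem_Icc.2 h9.le) h
      rw [hfm] at this
      exact (le_max_right _ _).trans_lt this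
    · exact h.trans_le ((le_max_left _ _).trans (hfmaps hd).1)
  have hcross : ∀ d ∈ Icc d₀ (min u₀ D₀), ∀ e ∈ Icc d₀ (min u₀ D₀),
      d < min u₀ D₀ ∨ D₀ < u₀ → f d ≠ e := fun d hd e he h =>
    ((he.2.trans (min_le_right _ _)).trans_lt (habove d h hd)).ne'
  refine ⟨hsub, ?_, ?_⟩
  · intro ρ₁ hρ₁ ρ₂ hρ₂ hne
    rcases (mem_binRt_iff h9 h10).1 hρ₁ with ⟨d, hd, hd', rfl⟩ | ⟨a, ha, rfl⟩ <;>
      rcases (mem_binRt_iff h9 h10).1 hρ₂ with ⟨e, he, he', rfl⟩ | ⟨b, hb, rfl⟩ <;>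
      simp only [atoms_mix_dirac hp0 hp1, atoms_dirac, disjoint_insert_left,
        disjoint_insert_right, disjoint_singleton, mem_insert_iff, mem_singleton_iff, not_or]
    · have hde : d ≠ e := fun h => hne (by rw [h])
      have hfde : f d ≠ f e := fun h => hde (hfanti.injOn hd he h)
      have hde' := hcross d hd e he hd'
      have hed' := hcross e he d hd he'
      grind
    · have hu := hbelow d hd' hd
      have hD := habove d hd' hd
      grind
    · have hu := hbelow e he' he
      have hD := habove e he' he
      grind
    · exact fun h => hne (by rw [h])
  · intro A _ hA
    refine ⟨fun H => ?_, fun H ρ hρ => H ρ (hsub hρ)⟩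
    have hgraph : ∀ d ∈ Icc d₀ (min u₀ D₀), d < min u₀ D₀ ∨ D₀ < u₀ → f d ∉ A ∧ d ∉ A :=
      fun d hd hd' => (mix_dirac_apply_eq_zero hp0 hp1 hA).1
        (H _ ((mem_binRt_iff h9 h10).2 (Or.inl ⟨d, hd, hd', rfl⟩)))
    have hoverlap : ∀ a ∈ Icc u₀ D₀, a ∉ A := by
      intro a ha
      have := H _ ((mem_binRt_iff h9 h10).2 (Or.inr ⟨a, ha, rfl⟩))
      simpa [hA] using this
    rintro _ ⟨u, hu, d, hd, p, hp, rfl⟩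
    refine (mix_dirac_apply_eq_zero (h1.trans_le hp.1) (hp.2.trans_lt h3) hA).2 ⟨?_, ?_⟩
    · by_cases huD : u ≤ D₀
      · exact hoverlap u ⟨hu.1, huD⟩
      · have hmem : u ∈ Icc (f (min u₀ D₀)) (f d₀) := by
          rw [hfm, hfd]
          exact ⟨max_le hu.1 (not_le.1 huD).le, hu.2⟩
        obtain ⟨e, he, rfl⟩ := intermediate_value_Icc' h9.le hfcont hmem
        refine (hgraph e he ?_).1
        by_contra! hcon
        have hem : e = min u₀ D₀ := le_antisymm he.2 hcon.1
        rw [hem, hfm] at huD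
        exact huD (max_le hcon.2 le_rfl)
    · by_cases hud : u₀ ≤ d
      · exact hoverlap d ⟨hud, hd.2⟩
      · have hdm : d ≤ min u₀ D₀ := le_min (not_le.1 hud).le hd.2
        refine (hgraph d ⟨hd.1, hdm⟩ ?_).2
        rcases lt_or_ge D₀ u₀ with h | h
        · exact Or.inr h
        · exact Or.inl (lt_min (not_le.1 hud) ((not_le.1 hud).trans_le h))
end

section
/- Let u₀, U₀, d₀, D₀, π₀, Π₀ ∈ ℝ satisfy 0 < π₀ ≤ Π₀ < 1, d₀ ≤ D₀, u₀ ≤ U₀, 0 < d₀ < 1 < U₀, d₀ < min(u₀, D₀) and max(u₀, D₀) < U₀. Set m₀ = min(u₀, D₀), M₀ = max(u₀, D₀), π̃ = (π₀+Π₀)/2, and let f : [d₀, m₀] → [M₀, U₀] be continuous and strictly decreasing with f(d₀) = U₀ and f(m₀) = M₀. Define ℛ and ℛ̃ on Ω = (0, ∞) with the Borel σ-algebra by ℛ = {π δ_u + (1−π) δ_d : u ∈ [u₀, U₀], d ∈ [d₀, D₀], π ∈ [π₀, Π₀]} and ℛ̃ = {π̃ δ_{f(d)} + (1−π̃) δ_d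 : d ∈ [d₀, m₀)} ∪ {δ_a : a ∈ [d₀, D₀] ∩ [u₀, U₀]} ∪ {π̃ δ_{f(d)} + (1−π̃) δ_d : d ∈ [m₀, D₀] ∩ [D₀, M₀)}. Then for every Q ∈ ℛ \ ℛ̃, with Q = π δ_{u_Q} + (1−π) δ_{d_Q} and support S_Q = {u_Q, d_Q}, there exist Q₁, Q₂ ∈ ℛ̃ such that S_Q ⊆ S_{Q₁} ∪ S_{Q₂} (supports taken as the sets of atoms); in particular Q ≪ (Q₁ + Q₂)/2. -/
open MeasureTheory Set
open scoped ENNReal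

/-- A combination of two Dirac masses is dominated by any measure charging both points. -/
theorem absolutelyContinuous_dirac_add_dirac {α : Type*} [MeasurableSpace α]
    [MeasurableSingletonClass α] {ν : Measure α} {x y : α} (a b : ℝ≥0∞)
    (hx : ν {x} ≠ 0) (hy : ν {y} ≠ 0) :
    a • Measure.dirac x + b • Measure.dirac y ≪ ν := by
  intro s hs
  have key : ∀ z, ν {z} ≠ 0 → Measure.dirac z s = 0 := by
    intro z hz
    have hzs : z ∉ s := fun h => hz (measure_mono_null (singleton_subset_iff.2 h) hs)
    simp [Measure.dirac_apply, hzs]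
  simp [key x hx, key y hy]

theorem dirac_add_dirac_singleton_left_ne_zero {α : Type*} [MeasurableSpace α]
    [MeasurableSingletonClass α] {a : ℝ≥0∞} (ha : a ≠ 0) (b : ℝ≥0∞) (x y : α) :
    (a • Measure.dirac x + b • Measure.dirac y) {x} ≠ 0 := by
  simp [ha]

theorem dirac_add_dirac_singleton_right_ne_zero {α : Type*} [MeasurableSpace α]
    [MeasurableSingletonClass α] (a : ℝ≥0∞) {b : ℝ≥0∞} (hb : b ≠ 0) (x y : α) :
    (a • Measure.dirac x + b • Measure.dirac y) {y} ≠ 0 := by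
  simp [hb]

/-- Every possible value of the one-step model is an atom of some law in `ℛ̃`. -/
theorem exists_mem_binRt_singleton_ne_zero {u₀ U₀ d₀ D₀ π₀ π₁ : ℝ}
    (h1 : 0 < π₀) (h2 : π₀ ≤ π₁) (h3 : π₁ < 1)
    (h9 : d₀ < min u₀ D₀) (h10 : max u₀ D₀ < U₀) {f : ℝ → ℝ}
    (hfcont : ContinuousOn f (Icc d₀ (min u₀ D₀)))
    (hfd : f d₀ = U₀) (hfm : f (min u₀ D₀) = max u₀ D₀) {x : ℝ}
    (hx : x ∈ Icc d₀ D₀ ∪ Icc u₀ U₀) :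
    ∃ ρ ∈ binRt u₀ U₀ d₀ D₀ π₀ π₁ f, ρ {x} ≠ 0 := by
  have hp : ENNReal.ofReal ((π₀ + π₁) / 2) ≠ 0 := by
    rw [Ne, ENNReal.ofReal_eq_zero]; linarith
  have hq : ENNReal.ofReal (1 - (π₀ + π₁) / 2) ≠ 0 := by
    rw [Ne, ENNReal.ofReal_eq_zero]; linarith
  have hivt : Icc (max u₀ D₀) U₀ ⊆ f '' Icc d₀ (min u₀ D₀) := by
    have := intermediate_value_Icc' h9.le hfcont
    rwa [hfd, hfm] at this
  have hpair : ∀ d ∈ Ico d₀ (min u₀ D₀), x = f d ∨ x = d →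
      ∃ ρ ∈ binRt u₀ U₀ d₀ D₀ π₀ π₁ f, ρ {x} ≠ 0 := by
    rintro d hd (rfl | rfl)
    · exact ⟨_, Or.inl (Or.inl ⟨d, hd, rfl⟩), dirac_add_dirac_singleton_left_ne_zero hp _ _ _⟩
    · exact ⟨_, Or.inl (Or.inl ⟨x, hd, rfl⟩), dirac_add_dirac_singleton_right_ne_zero _ hq _ _⟩
  have hx' : d₀ ≤ x ∧ x ≤ U₀ := by
    rcases hx with ⟨ha, hb⟩ | ⟨ha, hb⟩
    · exact ⟨ha, hb.trans ((le_max_right _ _).trans h10.le)⟩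
    · exact ⟨(h9.le.trans (min_le_left _ _)).trans ha, hb⟩
  rcases lt_or_ge x (min u₀ D₀) with hlt | hge
  · exact hpair x ⟨hx'.1, hlt⟩ (Or.inr rfl)
  rcases le_or_gt u₀ D₀ with hle | hgt
  · rw [min_eq_left hle] at *
    rw [max_eq_right hle] at *
    rcases le_or_gt x D₀ with hxD | hDx
    · exact ⟨_, Or.inl (Or.inr ⟨x, ⟨⟨hx'.1, hxD⟩, hge, hx'.2⟩, rfl⟩), by simp⟩
    · obtain ⟨d, hd, hdx⟩ := hivt ⟨hDx.le, hx'.2⟩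
      refine hpair d ⟨hd.1, lt_of_le_of_ne hd.2 ?_⟩ (Or.inl hdx.symm)
      rintro rfl
      linarith
  · have hmin := min_eq_right hgt.le
    have hmax := max_eq_left hgt.le
    have hmem : D₀ ∈ Icc (min u₀ D₀) D₀ ∩ Ico D₀ (max u₀ D₀) := by
      rw [hmin, hmax]; exact ⟨⟨le_rfl, le_rfl⟩, le_rfl, hgt⟩
    have hend : x = f D₀ ∨ x = D₀ → ∃ ρ ∈ binRt u₀ U₀ d₀ D₀ π₀ π₁ f, ρ {x} ≠ 0 := by
      rintro (h | h)
      · rw [h]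
        exact ⟨_, Or.inr ⟨D₀, hmem, rfl⟩, dirac_add_dirac_singleton_left_ne_zero hp _ _ _⟩
      · rw [h]
        exact ⟨_, Or.inr ⟨D₀, hmem, rfl⟩, dirac_add_dirac_singleton_right_ne_zero _ hq _ _⟩
    rw [hmin] at hge hivt hpair
    rw [hmax] at hivt
    rcases hx with hx | hx
    · exact hend (Or.inr (le_antisymm hx.2 hge))
    · obtain ⟨d, hd, hdx⟩ := hivt hx
      rcases hd.2.lt_or_eq with h | rfl
      · exact hpair d ⟨hd.1, h⟩ (Or.inl hdx.symm)
      · exact hend (Or.inl hdx.symm)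

/-- For every `Q = π δ_u + (1−π) δ_d ∈ ℛ \ ℛ̃` with support `{u, d}`,
there are `Q₁, Q₂ ∈ ℛ̃` whose supports (sets of atoms) cover `{u, d}`; in particular
`Q ≪ (Q₁ + Q₂)/2`. -/
theorem stmt18 (u₀ U₀ d₀ D₀ π₀ π₁ : ℝ)
    (h1 : 0 < π₀) (h2 : π₀ ≤ π₁) (h3 : π₁ < 1)
    (h4 : d₀ ≤ D₀) (h5 : u₀ ≤ U₀)
    (h6 : 0 < d₀) (h7 : d₀ < 1) (h8 : 1 < U₀)
    (h9 : d₀ < min u₀ D₀) (h10 : max u₀ D₀ < U₀)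
    (f : ℝ → ℝ)
    (hfanti : StrictAntiOn f (Icc d₀ (min u₀ D₀)))
    (hfcont : ContinuousOn f (Icc d₀ (min u₀ D₀)))
    (hfmaps : MapsTo f (Icc d₀ (min u₀ D₀)) (Icc (max u₀ D₀) U₀))
    (hfd : f d₀ = U₀) (hfm : f (min u₀ D₀) = max u₀ D₀) :
    ∀ ρ ∈ binR u₀ U₀ d₀ D₀ π₀ π₁, ρ ∉ binRt u₀ U₀ d₀ D₀ π₀ π₁ f →
      ∀ u ∈ Icc u₀ U₀, ∀ d ∈ Icc d₀ D₀, ∀ p ∈ Icc π₀ π₁,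
        ρ = ENNReal.ofReal p • Measure.dirac u + ENNReal.ofReal (1 - p) • Measure.dirac d →
        ∃ ρ₁ ∈ binRt u₀ U₀ d₀ D₀ π₀ π₁ f, ∃ ρ₂ ∈ binRt u₀ U₀ d₀ D₀ π₀ π₁ f,
          ({u, d} : Set ℝ) ⊆ {x : ℝ | ρ₁ {x} ≠ 0} ∪ {x : ℝ | ρ₂ {x} ≠ 0} ∧
          ρ ≪ (2⁻¹ : ℝ≥0∞) • (ρ₁ + ρ₂) := by
  rintro ρ - - u hu d hd p - rfl
  obtain ⟨ρ₁, hρ₁, hu₁⟩ := exists_mem_binRt_singleton_ne_zero h1 h2 h3 h9 h10 hfcont hfd hfm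
    (Or.inr hu)
  obtain ⟨ρ₂, hρ₂, hd₂⟩ := exists_mem_binRt_singleton_ne_zero h1 h2 h3 h9 h10 hfcont hfd hfm
    (Or.inl hd)
  refine ⟨ρ₁, hρ₁, ρ₂, hρ₂, ?_, absolutelyContinuous_dirac_add_dirac _ _ ?_ ?_⟩
  · rintro x (rfl | rfl)
    · exact Or.inl hu₁
    · exact Or.inr hd₂
  · simp [hu₁]
  · simp [hd₂]
end

section
/- Let 𝒫 be pre-Hahn-localizable on (Ω, ℱ) with strictly disjointly supported localization 𝒬 (supports S_Q pairwise disjoint), let H be the Hahn extension of ℱ, and let H₀ and H₁ be families of probability measures on ℱ with H₀ ⋘ 𝒫 and H₁ ⋘ 𝒫. For a probability measure ν on ℱ with ν ≪ P for some P ∈ 𝒫, let ν̂ be its extension to H given by ν̂(A) = ∑_{Q∈𝒬(ν)} ν(A ∩ S_Q) for A ∈ H. Then for every ε > 0 the following are equivalent: (i) there exists an H-measurable function φ : Ω → ℝ with 0 ≤ φ ≤ 1 outside a set A ∈ H with P̂(A) = 0 for all P ∈ 𝒫, such that inf_{ν ∈ H₁} ∫ φ dν̂ > sup_{μ ∈ H₀}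 ∫ φ dμ̂ + ε; (ii) inf { (1/2)‖μ − ν‖_TV : μ a finite convex combination of elements of H₀, ν a finite convex combination of elements of H₁ } > ε. -/
open MeasureTheory Set
open scoped ENNReal

variable {Ω : Type*}

/-- Bochner integral w.r.t. a measure on an explicitly given σ-algebra. -/
noncomputable def intOn (m' : MeasurableSpace Ω) (ρ : @Measure Ω m') (φ : Ω → ℝ) : ℝ :=
  ∫ ω, φ ω ∂ρ

/-- Finite convex combinations of elements of a family of measures. -/
def fconv [MeasurableSpace Ω] (A : Set (Measure Ω)) : Set (Measure Ω) :=
  {μ | ∃ (n : ℕ) (f : Fin n → Measure Ω) (w : Fin n → ℝ≥0∞),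
    (∀ i, f i ∈ A) ∧ (∑ i, w i) = 1 ∧ μ = ∑ i, w i • f i}

/-- The total variation distance `(1/2)‖μ − ν‖_TV = sup_A |μ(A) − ν(A)|` between
(probability) measures. -/
noncomputable def dTV [MeasurableSpace Ω] (μ ν : Measure Ω) : ℝ≥0∞ :=
  ⨆ (A : Set Ω) (_ : MeasurableSet A), (μ A - ν A) ⊔ (ν A - μ A)

open Filter Topology

/-- A continuous linear functional on `L¹(q)` of norm at most one is integration against a
measurable function bounded by one. -/
lemma exists_bounded_density [MeasurableSpace Ω] (q : Measure Ω) [IsProbabilityMeasure q]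
    (L : Lp ℝ 1 q →L[ℝ] ℝ) (hL : ∀ x, |L x| ≤ ‖x‖) :
    ∃ g : Ω → ℝ, Measurable g ∧ (∀ ω, |g ω| ≤ 1) ∧ ∀ x : Lp ℝ 1 q, L x = ∫ ω, g ω * x ω ∂q := by
  have h12 : ∀ x : Lp ℝ 2 q, MemLp x 1 q := fun x =>
    (Lp.memLp x).mono_exponent (by norm_num)
  let J : Lp ℝ 2 q →ₗ[ℝ] Lp ℝ 1 q :=
    { toFun := fun x => (h12 x).toLp x
      map_add' := fun x y => by
        rw [← MemLp.toLp_add]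
        exact MemLp.toLp_congr _ _ (Lp.coeFn_add x y)
      map_smul' := fun c x => by
        rw [RingHom.id_apply, ← MemLp.toLp_const_smul]
        exact MemLp.toLp_congr _ _ (Lp.coeFn_smul c x) }
  have hJ : ∀ x, ‖J x‖ ≤ 1 * ‖x‖ := fun x => by
    change ‖(h12 x).toLp x‖ ≤ _
    rw [Lp.norm_toLp, Lp.norm_def, one_mul]
    exact ENNReal.toReal_mono (Lp.eLpNorm_ne_top x)
      (eLpNorm_le_eLpNorm_of_exponent_le (by norm_num) (Lp.aestronglyMeasurable x))
  let g₀ : Lp ℝ 2 q := (InnerProductSpace.toDual ℝ _).symm (L.comp (J.mkContinuous 1 hJ))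
  have hind : ∀ (s : Set Ω) (hs : MeasurableSet s),
      L (indicatorConstLp 1 hs (measure_ne_top q s) 1) = ∫ ω in s, g₀ ω ∂q := fun s hs => by
    rw [← L2.inner_indicatorConstLp_one (𝕜 := ℝ) hs (measure_ne_top q s) g₀, real_inner_comm,
      InnerProductSpace.toDual_symm_apply]
    change _ = L ((h12 _).toLp _)
    congr 1
    exact (MemLp.toLp_congr _ _ indicatorConstLp_coeFn).symm
  have hg₀ : Integrable g₀ q := (h12 g₀).integrable le_rfl
  have hbd : ∀ s, MeasurableSet s → |∫ ω in s, g₀ ω ∂q| ≤ q.real s := fun s hs => by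
    rw [← hind s hs]
    refine (hL _).trans ?_
    rw [norm_indicatorConstLp one_ne_zero ENNReal.one_ne_top]
    simp
  have hle : g₀ ≤ᵐ[q] fun _ => (1 : ℝ) :=
    ae_le_of_forall_setIntegral_le hg₀ (integrable_const _) fun s hs _ => by
      simpa using (abs_le.1 (hbd s hs)).2
  have hge : (fun _ => (-1 : ℝ)) ≤ᵐ[q] g₀ :=
    ae_le_of_forall_setIntegral_le (integrable_const _) hg₀ fun s hs _ => by
      simpa using (abs_le.1 (hbd s hs)).1
  let g : Ω → ℝ := fun ω => max (-1) (min 1 (g₀ ω))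
  have hgm : Measurable g :=
    measurable_const.max (measurable_const.min (Lp.stronglyMeasurable g₀).measurable)
  have hg1 : ∀ ω, |g ω| ≤ 1 := fun ω =>
    abs_le.2 ⟨le_max_left _ _, max_le (by norm_num) (min_le_left _ _)⟩
  have hgg : g =ᵐ[q] g₀ := by
    filter_upwards [hle, hge] with ω h1 h2
    simp only [g, min_eq_right h1, max_eq_right h2]
  have hint : ∀ {f : Ω → ℝ}, Integrable f q → Integrable (fun ω => g ω * f ω) q := fun hf =>
    hf.bdd_mul hgm.aestronglyMeasurable (Eventually.of_forall hg1)
  refine ⟨g, hgm, hg1, fun x => ?_⟩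
  induction x using Lp.induction ENNReal.one_ne_top with
  | indicatorConst c hs hμs =>
    rename_i s
    rw [Lp.simpleFunc.coe_indicatorConst]
    have h1 : indicatorConstLp 1 hs hμs.ne c = c • indicatorConstLp 1 hs hμs.ne (1 : ℝ) := by
      refine Lp.ext ?_
      filter_upwards [indicatorConstLp_coeFn (p := 1) (hs := hs) (hμs := hμs.ne) (c := c),
        indicatorConstLp_coeFn (p := 1) (hs := hs) (hμs := hμs.ne) (c := (1 : ℝ)),
        Lp.coeFn_smul c (indicatorConstLp 1 hs hμs.ne (1 : ℝ))] with ω h h' h''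
      rw [h, h'', Pi.smul_apply, h']
      by_cases hω : ω ∈ s <;> simp [hω]
    have h2 : ∫ ω, g ω * indicatorConstLp 1 hs hμs.ne c ω ∂q = ∫ ω, s.indicator (fun ω => c * g₀ ω) ω ∂q := by
      refine integral_congr_ae ?_
      filter_upwards [indicatorConstLp_coeFn (p := 1) (hs := hs) (hμs := hμs.ne) (c := c), hgg]
        with ω h h'
      rw [h, h']
      by_cases hω : ω ∈ s <;> simp [hω, mul_comm]
    rw [h1, map_smul, hind, ← h1, h2, integral_indicator hs, integral_const_mul, smul_eq_mul]
  | add hf hg _ h1 h2 =>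
    rename_i f₁ f₂ _
    rw [map_add, h1, h2, ← integral_add (hint (L1.integrable_coeFn _)) (hint (L1.integrable_coeFn _))]
    refine integral_congr_ae ?_
    filter_upwards [Lp.coeFn_add (hf.toLp f₁) (hg.toLp f₂)] with ω h
    rw [h, Pi.add_apply, mul_add]
  | isClosed =>
    refine isClosed_eq L.continuous ?_
    refine (LipschitzWith.of_dist_le_mul (K := 1) fun x y => ?_).continuous
    rw [dist_eq_norm, dist_eq_norm, L1.norm_eq_integral_norm, NNReal.coe_one, one_mul,
      ← integral_sub (hint (L1.integrable_coeFn _)) (hint (L1.integrable_coeFn _))]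
    refine (norm_integral_le_integral_norm _).trans (integral_mono_ae ?_ ?_ ?_)
    · exact ((hint (L1.integrable_coeFn _)).sub (hint (L1.integrable_coeFn _))).norm
    · exact (L1.integrable_coeFn _).norm
    · filter_upwards [Lp.coeFn_sub x y] with ω h
      rw [h, Pi.sub_apply, ← mul_sub, norm_mul]
      exact mul_le_of_le_one_left (norm_nonneg _) (hg1 ω)

/-- A measure is carried by a family of sets if countably many of them cover it up to a
null set. -/
def Carried [MeasurableSpace Ω] {ι : Type*} (S : ι → Set Ω) (μ : Measure Ω) : Prop :=
  ∃ C : Set ι, C.Countable ∧ μ (⋃ i ∈ C, S i)ᶜ = 0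

section Carried

variable [MeasurableSpace Ω] {ι : Type*} {S : ι → Set Ω} {μ ν : Measure Ω}

lemma Carried.of_absolutelyContinuous (h : Carried S μ) (hν : ν ≪ μ) : Carried S ν :=
  let ⟨C, hC, h0⟩ := h
  ⟨C, hC, hν h0⟩

lemma Carried.sum_smul {n : ℕ} {f : Fin n → Measure Ω} (w : Fin n → ℝ≥0∞)
    (h : ∀ k, Carried S (f k)) : Carried S (∑ k, w k • f k) := by
  choose C hC h0 using h
  refine ⟨⋃ k, C k, countable_iUnion hC, ?_⟩
  rw [Measure.finsetSum_apply]
  refine Finset.sum_eq_zero fun k _ => ?_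
  rw [Measure.smul_apply, measure_mono_null _ (h0 k), smul_zero]
  exact compl_subset_compl.2 (biUnion_subset_biUnion_left (subset_iUnion C k))

lemma Carried.tsum_inter (hS : ∀ i, MeasurableSet (S i)) (hd : Pairwise (Function.onFun Disjoint S))
    (h : Carried S μ) {B : Set Ω} (hB : MeasurableSet B) : ∑' i, μ (B ∩ S i) = μ B := by
  obtain ⟨C, hC, h0⟩ := h
  have hsupp : Function.support (fun i => μ (B ∩ S i)) ⊆ C := fun i hi => by
    by_contra hiC
    refine hi (measure_mono_null ?_ h0)
    rintro ω ⟨-, hω⟩ hU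
    obtain ⟨j, hj, hωj⟩ := mem_iUnion₂.1 hU
    exact disjoint_left.1 (hd fun hij : i = j => hiC (hij ▸ hj)) hω hωj
  rw [← tsum_subtype_eq_of_support_subset hsupp,
    ← measure_biUnion hC (fun i _ j _ hij => (hd hij).mono inter_subset_right inter_subset_right)
      fun i _ => hB.inter (hS i), ← inter_iUnion₂]
  exact measure_inter_conull h0

lemma Carried.sum_restrict (hS : ∀ i, MeasurableSet (S i))
    (hd : Pairwise (Function.onFun Disjoint S)) (h : Carried S μ) :
    Measure.sum (fun i => μ.restrict (S i)) = μ := by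
  ext B hB
  simp only [Measure.sum_apply _ hB, Measure.restrict_apply hB, h.tsum_inter hS hd hB]

lemma Carried.hasSum_setIntegral (hS : ∀ i, MeasurableSet (S i))
    (hd : Pairwise (Function.onFun Disjoint S)) (h : Carried S μ) {f : Ω → ℝ}
    (hf : Integrable f μ) : HasSum (fun i => ∫ ω in S i, f ω ∂μ) (∫ ω, f ω ∂μ) := by
  have hs := h.sum_restrict hS hd
  have := hasSum_integral_measure (f := f) (μ := fun i => μ.restrict (S i)) (by rwa [hs])
  rwa [hs] at this

lemma Carried.hasSum_real_inter [IsFiniteMeasure μ] (hS : ∀ i, MeasurableSet (S i))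
    (hd : Pairwise (Function.onFun Disjoint S)) (h : Carried S μ) {B : Set Ω}
    (hB : MeasurableSet B) : HasSum (fun i => μ.real (B ∩ S i)) (μ.real B) := by
  have := h.tsum_inter hS hd hB
  have h2 := ENNReal.hasSum_toReal (f := fun i => μ (B ∩ S i)) (this ▸ measure_ne_top μ B)
  rwa [← ENNReal.tsum_toReal_eq fun i => measure_ne_top μ _, this] at h2

end Carried

lemma fconv_isProbabilityMeasure [MeasurableSpace Ω] {H : Set (Measure Ω)}
    (hH : ∀ μ ∈ H, IsProbabilityMeasure μ) {μ : Measure Ω} (h : μ ∈ fconv H) :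
    IsProbabilityMeasure μ := by
  obtain ⟨n, f, w, hf, hw, rfl⟩ := h
  refine ⟨?_⟩
  rw [Measure.finsetSum_apply, ← hw]
  refine Finset.sum_congr rfl fun k _ => ?_
  have := hH _ (hf k)
  simp

lemma Carried.of_mem_fconv [MeasurableSpace Ω] {ι : Type*} {S : ι → Set Ω} {H : Set (Measure Ω)}
    (hH : ∀ μ ∈ H, Carried S μ) {μ : Measure Ω} (h : μ ∈ fconv H) : Carried S μ := by
  obtain ⟨n, f, w, hf, -, rfl⟩ := h
  exact Carried.sum_smul w fun k => hH _ (hf k)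

lemma subset_fconv [MeasurableSpace Ω] (H : Set (Measure Ω)) : H ⊆ fconv H := fun μ hμ =>
  ⟨1, fun _ => μ, fun _ => 1, fun _ => hμ, by simp, by simp⟩

lemma fconv_convex [MeasurableSpace Ω] {H : Set (Measure Ω)} {μ ν : Measure Ω}
    (hμ : μ ∈ fconv H) (hν : ν ∈ fconv H) {a b : ℝ≥0∞} (hab : a + b = 1) :
    a • μ + b • ν ∈ fconv H := by
  obtain ⟨n, f, w, hf, hw, rfl⟩ := hμ
  obtain ⟨k, f', w', hf', hw', rfl⟩ := hν
  refine ⟨n + k, Fin.append f f', Fin.append (fun i => a * w i) (fun i => b * w' i), fun i => ?_,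
    ?_, ?_⟩
  · induction i using Fin.addCases with
    | left i => simpa using hf i
    | right i => simpa using hf' i
  · simp [Fin.sum_univ_add, ← Finset.mul_sum, hw, hw', hab]
  · simp [Fin.sum_univ_add, Finset.smul_sum, smul_smul]

section Density

variable [MeasurableSpace Ω] {ι : Type*} {q : ι → Measure Ω} {S : ι → Set Ω} {μ ν : Measure Ω}

/-- The `L¹(qᵢ)`-densities `xᵢ` represent the signed measure `ν - μ` on the sets `S i`. -/
def Represents (S : ι → Set Ω) (x : lp (fun i => Lp ℝ 1 (q i)) 1) (μ ν : Measure Ω) : Prop :=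
  ∀ i B, MeasurableSet B → ∫ ω in B, x i ω ∂q i = ν.real (B ∩ S i) - μ.real (B ∩ S i)

lemma Represents.convex_combination [IsFiniteMeasure μ] [IsFiniteMeasure ν] {μ' ν' : Measure Ω}
    [IsFiniteMeasure μ'] [IsFiniteMeasure ν'] {x y : lp (fun i => Lp ℝ 1 (q i)) 1}
    (hx : Represents S x μ ν) (hy : Represents S y μ' ν') {a b : ℝ} (ha : 0 ≤ a) (hb : 0 ≤ b) :
    Represents S (a • x + b • y) (ENNReal.ofReal a • μ + ENNReal.ofReal b • μ')
      (ENNReal.ofReal a • ν + ENNReal.ofReal b • ν') := fun i B hB => by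
  have h1 : ∫ ω in B, (a • x + b • y) i ω ∂q i
      = ∫ ω in B, (a * x i ω + b * y i ω) ∂q i := by
    refine integral_congr_ae (ae_restrict_of_ae ?_)
    filter_upwards [Lp.coeFn_add (a • x i) (b • y i), Lp.coeFn_smul a (x i),
      Lp.coeFn_smul b (y i)] with ω h h' h''
    rw [lp.coeFn_add, lp.coeFn_smul, lp.coeFn_smul, Pi.add_apply, Pi.smul_apply, Pi.smul_apply, h,
      Pi.add_apply, h', h'']
    simp
  have hi : ∀ z : Lp ℝ 1 (q i), Integrable z ((q i).restrict B) :=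
    fun z => (L1.integrable_coeFn z).restrict
  have hr : ∀ (ρ ρ' : Measure Ω) [IsFiniteMeasure ρ] [IsFiniteMeasure ρ'] (A : Set Ω),
      (ENNReal.ofReal a • ρ + ENNReal.ofReal b • ρ').real A = a * ρ.real A + b * ρ'.real A := by
    intro ρ ρ' _ _ A
    rw [Measure.real, Measure.add_apply, Measure.smul_apply, Measure.smul_apply, smul_eq_mul,
      smul_eq_mul, ENNReal.toReal_add (by finiteness) (by finiteness), ENNReal.toReal_mul,
      ENNReal.toReal_mul, ENNReal.toReal_ofReal ha, ENNReal.toReal_ofReal hb]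
    rfl
  rw [h1, integral_add ((hi _).const_mul a) ((hi _).const_mul b), integral_const_mul,
    integral_const_mul, hx i B hB, hy i B hB, hr, hr]
  ring

lemma Represents.dTV_le [IsProbabilityMeasure μ] [IsProbabilityMeasure ν]
    (hS : ∀ i, MeasurableSet (S i)) (hd : Pairwise (Function.onFun Disjoint S))
    (hμ : Carried S μ) (hν : Carried S ν) {x : lp (fun i => Lp ℝ 1 (q i)) 1}
    (hx : Represents S x μ ν) : dTV μ ν ≤ ENNReal.ofReal (‖x‖ / 2) := by
  have hsum : ∀ B, MeasurableSet B →
      HasSum (fun i => ∫ ω in B, x i ω ∂q i) (ν.real B - μ.real B) := fun B hB => by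
    simp only [hx _ B hB]
    exact (hν.hasSum_real_inter hS hd hB).sub (hμ.hasSum_real_inter hS hd hB)
  have hnorm : HasSum (fun i => ‖x i‖) ‖x‖ := by
    simpa using lp.hasSum_norm (p := 1) (by simp) x
  have key : ∀ B, MeasurableSet B → ν.real B - μ.real B ≤ ‖x‖ / 2 := fun B hB => by
    have h := hasSum_le (fun i => ?_) ((hsum B hB).sub (hsum Bᶜ hB.compl)) hnorm
    · rw [probReal_compl_eq_one_sub hB, probReal_compl_eq_one_sub hB] at h
      linarith
    · have hi := L1.integrable_coeFn (x i)
      rw [L1.norm_eq_integral_norm, ← integral_add_compl hB hi.norm]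
      have h1 := norm_integral_le_integral_norm (μ := (q i).restrict B) (x i)
      have h2 := norm_integral_le_integral_norm (μ := (q i).restrict Bᶜ) (x i)
      rw [Real.norm_eq_abs] at h1 h2
      linarith [(abs_le.1 h1).2, (abs_le.1 h2).1]
  refine iSup₂_le fun B hB => sup_le ?_ ?_
  · rw [← ofReal_measureReal (μ := μ), ← ofReal_measureReal (μ := ν),
      ← ENNReal.ofReal_sub _ measureReal_nonneg]
    refine ENNReal.ofReal_le_ofReal ?_
    have := key Bᶜ hB.compl
    rw [probReal_compl_eq_one_sub hB, probReal_compl_eq_one_sub hB] at this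
    linarith
  · rw [← ofReal_measureReal (μ := μ), ← ofReal_measureReal (μ := ν),
      ← ENNReal.ofReal_sub _ measureReal_nonneg]
    exact ENNReal.ofReal_le_ofReal (key B hB)

lemma exists_lp_rnDeriv [IsFiniteMeasure μ] (hS : ∀ i, MeasurableSet (S i))
    (hd : Pairwise (Function.onFun Disjoint S)) (hμ : Carried S μ)
    [∀ i, IsFiniteMeasure (q i)] (hac : ∀ i, μ.restrict (S i) ≪ q i) :
    ∃ x : lp (fun i => Lp ℝ 1 (q i)) 1,
      ∀ i, x i =ᵐ[q i] fun ω => ((μ.restrict (S i)).rnDeriv (q i) ω).toReal := by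
  let f : ∀ i, Lp ℝ 1 (q i) := fun i =>
    (Measure.integrable_toReal_rnDeriv (μ := μ.restrict (S i)) (ν := q i)).toL1 _
  have hf : ∀ i, f i =ᵐ[q i] fun ω => ((μ.restrict (S i)).rnDeriv (q i) ω).toReal :=
    fun i => Integrable.coeFn_toL1 _
  have hnorm : ∀ i, ‖f i‖ = μ.real (univ ∩ S i) := fun i => by
    rw [L1.norm_eq_integral_norm]
    have : ∫ ω, ‖f i ω‖ ∂q i = ∫ ω, ((μ.restrict (S i)).rnDeriv (q i) ω).toReal ∂q i := by
      refine integral_congr_ae ?_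
      filter_upwards [hf i] with ω h
      rw [h, Real.norm_of_nonneg ENNReal.toReal_nonneg]
    rw [this, Measure.integral_toReal_rnDeriv (hac i), measureReal_restrict_apply MeasurableSet.univ]
  refine ⟨⟨f, memℓp_gen ?_⟩, hf⟩
  simpa [hnorm] using (hμ.hasSum_real_inter hS hd MeasurableSet.univ).summable

lemma exists_represents [IsFiniteMeasure μ] [IsFiniteMeasure ν] (hS : ∀ i, MeasurableSet (S i))
    (hd : Pairwise (Function.onFun Disjoint S)) (hμ : Carried S μ) (hν : Carried S ν)
    [∀ i, IsFiniteMeasure (q i)] (hμq : ∀ i, μ.restrict (S i) ≪ q i)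
    (hνq : ∀ i, ν.restrict (S i) ≪ q i) :
    ∃ x : lp (fun i => Lp ℝ 1 (q i)) 1, Represents S x μ ν ∧
      ∀ (i : ι) (g : Ω → ℝ), Measurable g → (∀ ω, |g ω| ≤ 1) →
        ∫ ω, g ω * x i ω ∂q i = ∫ ω in S i, g ω ∂ν - ∫ ω in S i, g ω ∂μ := by
  obtain ⟨y, hy⟩ := exists_lp_rnDeriv hS hd hμ hμq
  obtain ⟨z, hz⟩ := exists_lp_rnDeriv hS hd hν hνq
  have key : ∀ (i : ι) (g : Ω → ℝ), Measurable g → (∀ ω, |g ω| ≤ 1) →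
      ∫ ω, g ω * (z - y) i ω ∂q i = ∫ ω in S i, g ω ∂ν - ∫ ω in S i, g ω ∂μ := by
    intro i g hg hg1
    have hint : ∀ ρ : Measure Ω, IsFiniteMeasure ρ →
        Integrable (fun ω => (ρ.rnDeriv (q i) ω).toReal • g ω) (q i) := fun ρ _ =>
      Measure.integrable_toReal_rnDeriv.mul_bdd (c := 1) hg.aestronglyMeasurable
        (Eventually.of_forall hg1)
    rw [← integral_rnDeriv_smul (hμq i), ← integral_rnDeriv_smul (hνq i),
      ← integral_sub (hint _ inferInstance) (hint _ inferInstance)]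
    refine integral_congr_ae ?_
    filter_upwards [hy i, hz i, Lp.coeFn_sub (z i) (y i)] with ω h h' h''
    rw [lp.coeFn_sub, Pi.sub_apply, h'', Pi.sub_apply, h, h', smul_eq_mul, smul_eq_mul]
    ring
  refine ⟨z - y, fun i B hB => ?_, key⟩
  have h := key i (B.indicator fun _ => 1) (measurable_const.indicator hB) fun ω => by
    by_cases hω : ω ∈ B <;> simp [hω]
  rw [setIntegral_indicator hB, setIntegral_indicator hB] at h
  simp only [setIntegral_const, smul_eq_mul, mul_one, inter_comm (S i)] at h
  rw [← h, ← integral_indicator hB]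
  refine integral_congr_ae (Eventually.of_forall fun ω => ?_)
  by_cases hω : ω ∈ B <;> simp [hω]

/-- If all convex combinations of `H0` and `H1` have total variation distance at least `r`, then
some bounded family of densities separates `H0` from `H1` uniformly. -/
lemma exists_separating_densities [∀ i, IsProbabilityMeasure (q i)]
    (hS : ∀ i, MeasurableSet (S i)) (hd : Pairwise (Function.onFun Disjoint S))
    {H0 H1 : Set (Measure Ω)} (hp0 : ∀ μ ∈ H0, IsProbabilityMeasure μ)
    (hp1 : ∀ μ ∈ H1, IsProbabilityMeasure μ) (hc0 : ∀ μ ∈ H0, Carried S μ)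
    (hc1 : ∀ μ ∈ H1, Carried S μ) (ha0 : ∀ μ ∈ H0, ∀ i, μ.restrict (S i) ≪ q i)
    (ha1 : ∀ μ ∈ H1, ∀ i, μ.restrict (S i) ≪ q i) {r : ℝ} (hr : 0 < r)
    (h : ∀ μ ∈ fconv H0, ∀ ν ∈ fconv H1, ENNReal.ofReal r ≤ dTV μ ν) :
    ∃ g : ι → Ω → ℝ, (∀ i, Measurable (g i)) ∧ (∀ i ω, |g i ω| ≤ 1) ∧
      ∀ μ ∈ H0, ∀ ν ∈ H1, ∃ s,
        HasSum (fun i => ∫ ω in S i, g i ω ∂ν - ∫ ω in S i, g i ω ∂μ) s ∧ 2 * r ≤ s := by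
  classical
  let K : Set (lp (fun i => Lp ℝ 1 (q i)) 1) :=
    {x | ∃ μ ∈ fconv H0, ∃ ν ∈ fconv H1, Represents S x μ ν}
  have hK : Convex ℝ K := by
    rintro x ⟨μ, hμ, ν, hν, hx⟩ y ⟨μ', hμ', ν', hν', hy⟩ a b ha hb hab
    have := fconv_isProbabilityMeasure hp0 hμ
    have := fconv_isProbabilityMeasure hp0 hμ'
    have := fconv_isProbabilityMeasure hp1 hν
    have := fconv_isProbabilityMeasure hp1 hν'
    have hab' : ENNReal.ofReal a + ENNReal.ofReal b = 1 := by
      rw [← ENNReal.ofReal_add ha hb, hab, ENNReal.ofReal_one]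
    exact ⟨_, fconv_convex hμ hμ' hab', _, fconv_convex hν hν' hab',
      hx.convex_combination hy ha hb⟩
  have hKr : Disjoint (Metric.ball 0 (2 * r)) K := by
    refine disjoint_left.2 fun x hxb hxK => ?_
    obtain ⟨μ, hμ, ν, hν, hx⟩ := hxK
    have := fconv_isProbabilityMeasure hp0 hμ
    have := fconv_isProbabilityMeasure hp1 hν
    have h1 := (h μ hμ ν hν).trans
      (hx.dTV_le hS hd (Carried.of_mem_fconv hc0 hμ) (Carried.of_mem_fconv hc1 hν))
    rw [ENNReal.ofReal_le_ofReal_iff (by positivity)] at h1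
    rw [mem_ball_zero_iff] at hxb
    linarith
  obtain ⟨F, u, hFu, huF⟩ := geometric_hahn_banach_open (convex_ball _ _) Metric.isOpen_ball hK hKr
  have hu : 0 < u := by simpa using hFu 0 (Metric.mem_ball_self (by positivity))
  let L := (2 * r / u) • F
  have hL1 : ∀ x, L x ≤ ‖x‖ := fun x => by
    refine le_of_forall_gt fun t ht => ?_
    have ht0 : 0 < t := (norm_nonneg x).trans_lt ht
    have h1 := hFu ((2 * r / t) • x) (by
      rw [mem_ball_zero_iff, norm_smul, Real.norm_of_nonneg (by positivity), div_mul_eq_mul_div,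
        div_lt_iff₀ ht0]
      gcongr)
    rw [map_smul, smul_eq_mul, div_mul_eq_mul_div, div_lt_iff₀ ht0] at h1
    change 2 * r / u * F x < t
    rw [div_mul_eq_mul_div, div_lt_iff₀ hu]
    linarith
  have hL : ∀ x, |L x| ≤ ‖x‖ := fun x =>
    abs_le.2 ⟨by have := hL1 (-x); rw [map_neg, norm_neg] at this; linarith, hL1 x⟩
  let M : ∀ i, Lp ℝ 1 (q i) →L[ℝ] ℝ := fun i =>
    L.comp (lp.singleContinuousLinearMap ℝ (fun i => Lp ℝ 1 (q i)) 1 i)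
  have hM : ∀ i y, M i y = L (lp.single 1 i y) := fun _ _ => rfl
  have hM1 : ∀ i y, |M i y| ≤ ‖y‖ := fun i y => by
    rw [hM]
    exact (hL _).trans_eq (lp.norm_single (E := fun i => Lp ℝ 1 (q i)) one_pos i y)
  choose g hgm hg1 hg using fun i => exists_bounded_density (q i) (M i) (hM1 i)
  refine ⟨g, hgm, hg1, fun μ hμ ν hν => ?_⟩
  have := hp0 μ hμ
  have := hp1 ν hν
  obtain ⟨x, hx, hxg⟩ := exists_represents hS hd (hc0 μ hμ) (hc1 ν hν) (ha0 μ hμ) (ha1 ν hν)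
  refine ⟨L x, ?_, ?_⟩
  · have := (lp.hasSum_single ENNReal.one_ne_top x).mapL L
    simpa only [← hxg _ (g _) (hgm _) (hg1 _), ← hg, hM] using this
  · have h1 := huF x ⟨μ, subset_fconv _ hμ, ν, subset_fconv _ hν, hx⟩
    change 2 * r ≤ 2 * r / u * F x
    rw [div_mul_eq_mul_div, le_div_iff₀ hu]
    gcongr

end Density

lemma lintegral_le_add_dTV [MeasurableSpace Ω] {μ ν : Measure Ω} {f : Ω → ℝ} (hf : Measurable f)
    (h0 : ∀ ω, 0 ≤ f ω) (h1 : ∀ ω, f ω ≤ 1) :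
    ∫⁻ ω, ENNReal.ofReal (f ω) ∂ν ≤ ∫⁻ ω, ENNReal.ofReal (f ω) ∂μ + dTV μ ν := by
  rw [lintegral_eq_lintegral_meas_lt ν (Eventually.of_forall h0) hf.aemeasurable,
    lintegral_eq_lintegral_meas_lt μ (Eventually.of_forall h0) hf.aemeasurable]
  calc ∫⁻ t in Ioi 0, ν {a | t < f a}
      ≤ ∫⁻ t in Ioi 0, (μ {a | t < f a} + (Iio (1 : ℝ)).indicator (fun _ => dTV μ ν) t) := by
        refine lintegral_mono fun t => ?_
        by_cases ht : t < 1
        · rw [indicator_of_mem (mem_Iio.2 ht), ← tsub_le_iff_left]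
          exact le_sup_right.trans (le_iSup₂_of_le {a | t < f a}
            (measurableSet_lt measurable_const hf) le_rfl)
        · have : {a | t < f a} = ∅ := eq_empty_of_forall_notMem fun a ha =>
            ht (lt_of_lt_of_le ha (h1 a))
          simp [this]
    _ = _ := by
        rw [lintegral_add_right _ (measurable_const.indicator measurableSet_Iio),
          lintegral_indicator measurableSet_Iio, setLIntegral_const,
          Measure.restrict_apply measurableSet_Iio, Iio_inter_Ioi]
        simp

lemma ofReal_integral_sub_le_dTV [MeasurableSpace Ω] {μ ν : Measure Ω} [IsFiniteMeasure μ]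
    [IsFiniteMeasure ν] {f : Ω → ℝ} (hf : Measurable f)
    (h0 : ∀ ω, 0 ≤ f ω) (h1 : ∀ ω, f ω ≤ 1) :
    ENNReal.ofReal (∫ ω, f ω ∂ν - ∫ ω, f ω ∂μ) ≤ dTV μ ν := by
  have hint : ∀ (ρ : Measure Ω) [IsFiniteMeasure ρ], Integrable f ρ := fun ρ _ =>
    Integrable.of_bound hf.aestronglyMeasurable 1 (Eventually.of_forall fun ω => by
      rw [Real.norm_of_nonneg (h0 ω)]; exact h1 ω)
  rw [ENNReal.ofReal_sub _ (integral_nonneg h0), tsub_le_iff_left,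
    ofReal_integral_eq_lintegral_ofReal (hint ν) (Eventually.of_forall h0),
    ofReal_integral_eq_lintegral_ofReal (hint μ) (Eventually.of_forall h0)]
  exact lintegral_le_add_dTV hf h0 h1

lemma integral_le_of_mem_fconv [MeasurableSpace Ω] {H : Set (Measure Ω)} {f : Ω → ℝ}
    {s : ℝ} (hi : ∀ μ ∈ H, Integrable f μ) (h : ∀ μ ∈ H, ∫ ω, f ω ∂μ ≤ s)
    {μ : Measure Ω} (hμ : μ ∈ fconv H) : ∫ ω, f ω ∂μ ≤ s := by
  obtain ⟨n, F, w, hF, hw, rfl⟩ := hμ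
  have hwt : ∀ k, w k ≠ ∞ := fun k =>
    ne_top_of_le_ne_top ENNReal.one_ne_top
      (hw ▸ Finset.single_le_sum (fun _ _ => zero_le) (Finset.mem_univ k))
  have hw1 : ∑ k, (w k).toReal = 1 := by
    rw [← ENNReal.toReal_sum fun k _ => hwt k, hw, ENNReal.toReal_one]
  rw [integral_finsetSum_measure fun k _ => (hi _ (hF k)).smul_measure (hwt k)]
  calc ∑ k, ∫ ω, f ω ∂(w k • F k) ≤ ∑ k, (w k).toReal * s := by
        refine Finset.sum_le_sum fun k _ => ?_
        rw [integral_smul_measure, smul_eq_mul]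
        exact mul_le_mul_of_nonneg_left (h _ (hF k)) ENNReal.toReal_nonneg
    _ = s := by rw [← Finset.sum_mul, hw1, one_mul]

lemma exists_countable_of_mem_fconv [MeasurableSpace Ω] {ι : Type*} {S : ι → Set Ω}
    {H : Set (Measure Ω)} (hH : ∀ μ ∈ H, Carried S μ) {μ : Measure Ω} (h : μ ∈ fconv H) :
    ∃ C : Set ι, C.Countable ∧ μ ∈ fconv {ν ∈ H | ν (⋃ i ∈ C, S i)ᶜ = 0} := by
  obtain ⟨n, F, w, hF, hw, rfl⟩ := h
  choose C hC h0 using fun k => hH _ (hF k)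
  refine ⟨⋃ k, C k, countable_iUnion hC, n, F, w, fun k => ⟨hF k, ?_⟩, hw, rfl⟩
  exact measure_mono_null
    (compl_subset_compl.2 (biUnion_subset_biUnion_left (subset_iUnion C k))) (h0 k)

lemma intOn_congr {m' : MeasurableSpace Ω} {ρ : @Measure Ω m'} {A : Set Ω}
    (hA : mApply m' ρ A = 0) {φ ψ : Ω → ℝ} (h : ∀ ω ∉ A, φ ω = ψ ω) :
    intOn m' ρ φ = intOn m' ρ ψ := by
  refine integral_congr_ae (measure_mono_null (fun ω hω => ?_) hA)
  by_contra hωA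
  exact hω (h ω hωA)

lemma intOn_eq_of_le {m m' : MeasurableSpace Ω} (hm : m ≤ m') {ρ : @Measure Ω m'}
    {ν : @Measure Ω m} (h : ∀ A, MeasurableSet[m] A → mApply m' ρ A = ν A) {φ : Ω → ℝ}
    (hφ : Measurable[m] φ) : intOn m' ρ φ = intOn m ν φ := by
  have hν : ρ.trim hm = ν := @Measure.ext _ m _ _ fun A hA => by
    rw [trim_measurableSet_eq hm hA]
    exact h A hA
  rw [intOn, integral_trim hm hφ.stronglyMeasurable, hν, intOn]

section Hahn

variable [m : MeasurableSpace Ω] {Q : Set (Measure Ω)} {S : Measure Ω → Set Ω}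

lemma le_hahnExt : m ≤ hahnExt Q S := le_sup_left

lemma MeasurableSet.inter_of_hahnExt (hS : ∀ q ∈ Q, MeasurableSet (S q))
    (hd : ∀ q ∈ Q, ∀ r ∈ Q, q ≠ r → Disjoint (S q) (S r)) {A : Set Ω}
    (hA : MeasurableSet[hahnExt Q S] A) {q : Measure Ω} (hq : q ∈ Q) :
    MeasurableSet (A ∩ S q) := by
  have hle : hahnExt Q S ≤ MeasurableSpace.map ((↑) : S q → Ω) (MeasurableSpace.comap (↑) m) := by
    refine sup_le (fun B hB => ⟨B, hB, rfl⟩) (MeasurableSpace.generateFrom_le ?_)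
    rintro _ ⟨E, hE, rfl⟩
    refine ⟨E q, (hE q hq).1, ?_⟩
    ext ⟨ω, hω⟩
    simp only [mem_preimage, mem_iUnion]
    refine ⟨fun h => ⟨q, hq, h⟩, ?_⟩
    rintro ⟨r, hr, h⟩
    by_cases hqr : q = r
    · rwa [hqr]
    · exact absurd ((hE r hr).2 h) (disjoint_left.1 (hd q hq r hr hqr) hω)
  obtain ⟨B, hB, hBA⟩ := hle A hA
  rw [Subtype.preimage_val_eq_preimage_val_iff, inter_comm, inter_comm _ A] at hBA
  rw [← hBA]
  exact hB.inter (hS q hq)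

lemma measurableSet_hahnExt_iUnion {E : Q → Set Ω} (hE : ∀ i, MeasurableSet (E i))
    (hES : ∀ i, E i ⊆ S i) : MeasurableSet[hahnExt Q S] (⋃ i, E i) := by
  classical
  refine le_sup_right (a := m) _ (MeasurableSpace.measurableSet_generateFrom
    ⟨fun q => if h : q ∈ Q then E ⟨q, h⟩ else ∅, fun q hq => ?_, ?_⟩)
  · simpa [hq] using ⟨hE ⟨q, hq⟩, hES ⟨q, hq⟩⟩
  · ext ω
    simp +contextual

lemma measurable_hahnExt {h : Q → Ω → ℝ} (hS : ∀ q ∈ Q, MeasurableSet (S q))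
    (hh : ∀ i, Measurable (h i)) {φ : Ω → ℝ} (hφ : ∀ (i : Q), ∀ ω ∈ S i, φ ω = h i ω)
    (hφ0 : ∀ ω, (∀ i : Q, ω ∉ S i) → φ ω = 0) : Measurable[hahnExt Q S] φ := by
  intro B hB
  have heq : φ ⁻¹' B = (⋃ i : Q, S i ∩ h i ⁻¹' B) ∪ ((⋃ i : Q, S i)ᶜ ∩ {_ω | (0 : ℝ) ∈ B}) := by
    ext ω
    by_cases hω : ∃ i : Q, ω ∈ S i
    · obtain ⟨i, hi⟩ := hω
      simp only [mem_preimage, mem_union, mem_iUnion, mem_inter_iff, mem_compl_iff]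
      constructor
      · exact fun hB => Or.inl ⟨i, hi, hφ i ω hi ▸ hB⟩
      · rintro (⟨j, hj, hjB⟩ | ⟨hn, -⟩)
        · rwa [hφ j ω hj]
        · exact absurd ⟨i, hi⟩ hn
    · push Not at hω
      simp only [mem_preimage, mem_union, mem_iUnion, mem_inter_iff, mem_compl_iff, mem_ofPred_eq,
        hφ0 ω hω]
      exact ⟨fun h => Or.inr ⟨fun ⟨i, hi⟩ => hω i hi, h⟩,
        fun h => h.elim (fun ⟨i, hi, _⟩ => absurd hi (hω i)) And.right⟩
  rw [heq]
  refine MeasurableSet.union ?_ (MeasurableSet.inter ?_ (MeasurableSet.const _))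
  · exact measurableSet_hahnExt_iUnion (fun i => (hS i i.2).inter (hh i hB))
      fun i => inter_subset_left
  · exact (measurableSet_hahnExt_iUnion (fun i => hS i i.2) fun i => subset_rfl).compl

lemma Measurable.indicator_of_hahnExt (hS : ∀ q ∈ Q, MeasurableSet (S q))
    (hd : ∀ q ∈ Q, ∀ r ∈ Q, q ≠ r → Disjoint (S q) (S r)) {φ : Ω → ℝ}
    (hφ : Measurable[hahnExt Q S] φ) {C : Set Q} (hC : C.Countable) :
    Measurable ((⋃ i ∈ C, S i).indicator φ) := by
  intro B hB
  rw [indicator_preimage]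
  refine MeasurableSet.union ?_ (((measurable_const (a := (0 : ℝ))) hB).diff
    (MeasurableSet.biUnion hC fun i _ => hS i i.2))
  rw [inter_iUnion₂]
  exact MeasurableSet.biUnion hC fun i _ => (hφ hB).inter_of_hahnExt hS hd i.2

lemma IsPreHahnLoc.carried_and_restrict_absolutelyContinuous {P : Set (Measure Ω)}
    (hpre : IsPreHahnLoc P Q S) {μ p : Measure Ω} (hp : p ∈ P) (hμ : μ ≪ p) :
    Carried (fun i : Q => S i) μ ∧ ∀ i : Q, μ.restrict (S i) ≪ i := by
  obtain ⟨σ, ⟨f, l, hf, -, rfl⟩, hpσ⟩ := hpre.ps p hp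
  have hμσ := hμ.trans hpσ
  have hSm : ∀ i : Q, MeasurableSet (S i) := fun i => hpre.measS i i.2
  refine ⟨Carried.of_absolutelyContinuous ⟨range fun k => ⟨f k, hf k⟩, countable_range _, ?_⟩ hμσ,
    fun i => Measure.AbsolutelyContinuous.mk fun B hB hB0 => ?_⟩
  · rw [Measure.sum_apply _
      (MeasurableSet.biUnion (countable_range _) fun i _ => hSm i).compl, ENNReal.tsum_eq_zero]
    intro k
    have := hpre.probQ _ (hf k)
    rw [Measure.smul_apply, measure_mono_null _
      ((prob_compl_eq_zero_iff (hpre.measS _ (hf k))).2 (hpre.self _ (hf k))), smul_zero]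
    exact compl_subset_compl.2 fun ω hω => mem_iUnion₂.2 ⟨⟨f k, hf k⟩, mem_range_self k, hω⟩
  · rw [Measure.restrict_apply hB]
    refine hμσ ?_
    rw [Measure.sum_apply _ (hB.inter (hSm i)), ENNReal.tsum_eq_zero]
    intro k
    rw [Measure.smul_apply, smul_eq_mul, mul_eq_zero]
    right
    by_cases hk : f k = i
    · exact measure_mono_null inter_subset_left (hk ▸ hB0)
    · exact measure_mono_null inter_subset_right (hpre.other _ (hf k) _ i.2 hk)

lemma tsum_hahn_eq (ν : Measure Ω) (A : Set Ω) :
    ∑' q : {q // q ∈ Q ∧ 0 < ν (S q)}, ν (A ∩ S q.1) = ∑' i : Q, ν (A ∩ S i) := by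
  refine (tsum_subtype {q | q ∈ Q ∧ 0 < ν (S q)} fun q => ν (A ∩ S q)).trans
    (Eq.trans ?_ (tsum_subtype Q fun q => ν (A ∩ S q)).symm)
  congr 1
  ext q
  by_cases hq : q ∈ Q
  · by_cases h0 : 0 < ν (S q)
    · simp [hq, h0]
    · have : ν (A ∩ S q) = 0 := measure_mono_null inter_subset_right (by simpa using h0)
      simp [hq, h0, this]
  · simp [hq]

/-- The integral of a test with respect to the extended measure is an integral with respect to
the original measure. -/
lemma intOn_hahnExt_eq (hS : ∀ q ∈ Q, MeasurableSet (S q))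
    (hd : ∀ q ∈ Q, ∀ r ∈ Q, q ≠ r → Disjoint (S q) (S r)) {ν : Measure Ω}
    {ρ : @Measure Ω (hahnExt Q S)}
    (hρ : ∀ A, MeasurableSet[hahnExt Q S] A →
      mApply (hahnExt Q S) ρ A = ∑' i : Q, ν (A ∩ S i))
    {C : Set Q} (hC : C.Countable) (hν : ν (⋃ i ∈ C, S i)ᶜ = 0) {φ : Ω → ℝ}
    (hφ : Measurable[hahnExt Q S] φ) :
    intOn (hahnExt Q S) ρ φ = ∫ ω, (⋃ i ∈ C, S i).indicator φ ω ∂ν := by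
  have hdp : Pairwise (Function.onFun Disjoint fun i : Q => S i) := fun i j hij =>
    hd i i.2 j j.2 (Subtype.coe_ne_coe.2 hij)
  have hρm : ∀ A, MeasurableSet A → mApply (hahnExt Q S) ρ A = ν A := fun A hA => by
    rw [hρ A (le_hahnExt A hA), Carried.tsum_inter (fun i : Q => hS i i.2) hdp ⟨C, hC, hν⟩ hA]
  have hU : MeasurableSet (⋃ i ∈ C, S i) := MeasurableSet.biUnion hC fun i _ => hS i i.2
  rw [intOn_congr ((hρm _ hU.compl).trans hν) fun ω hω =>
    (indicator_of_mem (not_not.1 hω) φ).symm]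
  exact intOn_eq_of_le le_hahnExt hρm (hφ.indicator_of_hahnExt hS hd hC)

end Hahn

/-- Robust Kraft-type characterization of strictly unbiased tests: on the
Hahn extension of a pre-Hahn-localizable model with strictly disjointly supported
localization, for hypotheses `H0, H1 ⋘ P` and every `ε > 0`, there is a test `φ`
(`H`-measurable, `[0,1]`-valued 𝒫-q.s. for the extended measures) with
`inf_{ν ∈ H1} ∫ φ dν̂ > sup_{μ ∈ H0} ∫ φ dμ̂ + ε` iff the total variation distance between
the convex hulls of `H0` and `H1` exceeds `ε`. -/
theorem stmt19 [m : MeasurableSpace Ω] (P Q : Set (Measure Ω)) (S : Measure Ω → Set Ω)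
    (hpre : IsPreHahnLoc P Q S)
    (hdisj : ∀ q ∈ Q, ∀ r ∈ Q, q ≠ r → Disjoint (S q) (S r))
    (H0 H1 : Set (Measure Ω))
    (hH0p : ∀ μ ∈ H0, IsProbabilityMeasure μ) (hH1p : ∀ ν ∈ H1, IsProbabilityMeasure ν)
    (hH0 : Lll H0 P) (hH1 : Lll H1 P)
    (hH0ne : H0.Nonempty) (hH1ne : H1.Nonempty)
    (ext : Measure Ω → @Measure Ω (hahnExt Q S))
    (hext : ∀ ν : Measure Ω, ν ∈ H0 ∪ H1 ∪ P → ∀ A : Set Ω, MeasurableSet[hahnExt Q S] A →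
      mApply (hahnExt Q S) (ext ν) A = ∑' q : {q // q ∈ Q ∧ 0 < ν (S q)}, ν (A ∩ S q.1))
    (ε : ℝ) (hε : 0 < ε) :
    (∃ φ : Ω → ℝ, Measurable[hahnExt Q S] φ ∧
      (∃ A : Set Ω, MeasurableSet[hahnExt Q S] A ∧
        (∀ p ∈ P, mApply (hahnExt Q S) (ext p) A = 0) ∧
        ∀ ω ∉ A, 0 ≤ φ ω ∧ φ ω ≤ 1) ∧
      sSup ((fun μ => intOn (hahnExt Q S) (ext μ) φ) '' H0) + ε <
        sInf ((fun ν => intOn (hahnExt Q S) (ext ν) φ) '' H1)) ↔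
    ENNReal.ofReal ε < ⨅ μ ∈ fconv H0, ⨅ ν ∈ fconv H1, dTV μ ν := by
  have hSm := hpre.measS
  have hSi : ∀ i : Q, MeasurableSet (S i) := fun i => hSm i i.2
  have hdp : Pairwise (Function.onFun Disjoint fun i : Q => S i) := fun i j hij =>
    hdisj i i.2 j j.2 (Subtype.coe_ne_coe.2 hij)
  have hρ : ∀ ν ∈ H0 ∪ H1 ∪ P, ∀ A, MeasurableSet[hahnExt Q S] A →
      mApply (hahnExt Q S) (ext ν) A = ∑' i : Q, ν (A ∩ S i) := fun ν hν A hA =>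
    (hext ν hν A hA).trans (tsum_hahn_eq ν A)
  have hadapt : ∀ μ ∈ H0 ∪ H1, Carried (fun i : Q => S i) μ ∧ ∀ i : Q, μ.restrict (S i) ≪ i := by
    rintro μ (hμ | hμ)
    · obtain ⟨p, hp, hμp⟩ := hH0 μ hμ
      exact hpre.carried_and_restrict_absolutelyContinuous hp hμp
    · obtain ⟨p, hp, hμp⟩ := hH1 μ hμ
      exact hpre.carried_and_restrict_absolutelyContinuous hp hμp
  have hprob : ∀ μ ∈ H0 ∪ H1, IsProbabilityMeasure μ := by
    rintro μ (hμ | hμ)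
    exacts [hH0p μ hμ, hH1p μ hμ]
  have hbdd : ∀ {φ : Ω → ℝ}, Measurable[hahnExt Q S] φ → (∀ ω, 0 ≤ φ ω ∧ φ ω ≤ 1) →
      ∀ {C : Set Q}, C.Countable → Measurable ((⋃ i ∈ C, S i).indicator φ) ∧
        (∀ ω, 0 ≤ (⋃ i ∈ C, S i).indicator φ ω) ∧ (∀ ω, (⋃ i ∈ C, S i).indicator φ ω ≤ 1) ∧
        ∀ (μ : Measure Ω) [IsProbabilityMeasure μ], Integrable ((⋃ i ∈ C, S i).indicator φ) μ := by
    intro φ hφ h01 C hC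
    have hm := hφ.indicator_of_hahnExt hSm hdisj hC
    have h0 : ∀ ω, 0 ≤ (⋃ i ∈ C, S i).indicator φ ω := indicator_nonneg fun ω _ => (h01 ω).1
    have h1 : ∀ ω, (⋃ i ∈ C, S i).indicator φ ω ≤ 1 :=
      indicator_le' (fun ω _ => (h01 ω).2) fun _ _ => zero_le_one
    exact ⟨hm, h0, h1, fun μ _ => Integrable.of_bound hm.aestronglyMeasurable 1
      (Eventually.of_forall fun ω => by rw [Real.norm_of_nonneg (h0 ω)]; exact h1 ω)⟩
  constructor
  · rintro ⟨φ, hφ, ⟨A, hA, hAP, hA01⟩, hlt⟩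
    have hA0 : ∀ μ ∈ H0 ∪ H1, mApply (hahnExt Q S) (ext μ) A = 0 := by
      intro μ hμ
      obtain ⟨p, hp, hμp⟩ : ∃ p ∈ P, μ ≪ p := hμ.elim (hH0 μ) (hH1 μ)
      have h := hAP p hp
      rw [hρ p (Or.inr hp) A hA, ENNReal.tsum_eq_zero] at h
      rw [hρ μ (Or.inl hμ) A hA, ENNReal.tsum_eq_zero]
      exact fun i => hμp (h i)
    set ψ : Ω → ℝ := Aᶜ.indicator φ with hψ
    have hψm : Measurable[hahnExt Q S] ψ :=
      @Measurable.indicator Ω ℝ Aᶜ φ (hahnExt Q S) _ _ hφ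
        (@MeasurableSet.compl _ _ (hahnExt Q S) hA)
    have hψ01 : ∀ ω, 0 ≤ ψ ω ∧ ψ ω ≤ 1 := fun ω => by
      by_cases hω : ω ∈ A
      · simp [hψ, hω]
      · simpa [hψ, hω] using hA01 ω hω
    have hφψ : ∀ μ ∈ H0 ∪ H1,
        intOn (hahnExt Q S) (ext μ) φ = intOn (hahnExt Q S) (ext μ) ψ := fun μ hμ =>
      intOn_congr (hA0 μ hμ) fun ω hω => (indicator_of_mem (by exact hω) φ).symm
    have hI : ∀ μ ∈ H0 ∪ H1, ∀ {C : Set Q}, C.Countable → μ (⋃ i ∈ C, S i)ᶜ = 0 →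
        intOn (hahnExt Q S) (ext μ) φ = ∫ ω, (⋃ i ∈ C, S i).indicator ψ ω ∂μ :=
      fun μ hμ C hC h0 => (hφψ μ hμ).trans
        (intOn_hahnExt_eq hSm hdisj (hρ μ (Or.inl hμ)) hC h0 hψm)
    have hI01 : ∀ μ ∈ H0 ∪ H1, 0 ≤ intOn (hahnExt Q S) (ext μ) φ ∧
        intOn (hahnExt Q S) (ext μ) φ ≤ 1 := by
      intro μ hμ
      obtain ⟨C, hC, h0⟩ := (hadapt μ hμ).1
      have := hprob μ hμ
      obtain ⟨-, hn, hl, hint⟩ := hbdd hψm hψ01 hC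
      rw [hI μ hμ hC h0]
      refine ⟨integral_nonneg hn, ?_⟩
      simpa using integral_mono (hint μ) (integrable_const (1 : ℝ)) hl
    set s := sSup ((fun μ => intOn (hahnExt Q S) (ext μ) φ) '' H0)
    set t := sInf ((fun ν => intOn (hahnExt Q S) (ext ν) φ) '' H1)
    have hs : ∀ μ ∈ H0, intOn (hahnExt Q S) (ext μ) φ ≤ s := fun μ hμ =>
      le_csSup ⟨1, by rintro _ ⟨μ', hμ', rfl⟩; exact (hI01 μ' (Or.inl hμ')).2⟩ ⟨μ, hμ, rfl⟩
    have ht : ∀ ν ∈ H1, t ≤ intOn (hahnExt Q S) (ext ν) φ := fun ν hν =>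
      csInf_le ⟨0, by rintro _ ⟨ν', hν', rfl⟩; exact (hI01 ν' (Or.inr hν')).1⟩ ⟨ν, hν, rfl⟩
    have hlt' : ENNReal.ofReal ε < ENNReal.ofReal (t - s) :=
      (ENNReal.ofReal_lt_ofReal_iff_of_nonneg hε.le).2 (by linarith)
    refine hlt'.trans_le (le_iInf₂ fun μ hμ => le_iInf₂ fun ν hν => ?_)
    have := fconv_isProbabilityMeasure hH0p hμ
    have := fconv_isProbabilityMeasure hH1p hν
    obtain ⟨C, hC, hμC⟩ := exists_countable_of_mem_fconv
      (fun μ hμ => (hadapt μ (Or.inl hμ)).1) hμ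
    obtain ⟨D, hD, hνD⟩ := exists_countable_of_mem_fconv
      (fun μ hμ => (hadapt μ (Or.inr hμ)).1) hν
    have hCD := hC.union hD
    obtain ⟨hm, hn, hl, hint⟩ := hbdd hψm hψ01 hCD
    refine le_trans (ENNReal.ofReal_le_ofReal ?_) (ofReal_integral_sub_le_dTV hm hn hl)
    have h1 : ∫ ω, (⋃ i ∈ C ∪ D, S i).indicator ψ ω ∂μ ≤ s := by
      refine integral_le_of_mem_fconv (fun μ' hμ' => ?_) (fun μ' hμ' => ?_) hμC
      · have := hH0p μ' hμ'.1
        exact hint μ'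
      · rw [← hI μ' (Or.inl hμ'.1) hCD (measure_mono_null
          (compl_subset_compl.2 (biUnion_subset_biUnion_left subset_union_left)) hμ'.2)]
        exact hs μ' hμ'.1
    have h2 : ∫ ω, -(⋃ i ∈ C ∪ D, S i).indicator ψ ω ∂ν ≤ -t := by
      refine integral_le_of_mem_fconv (fun μ' hμ' => ?_) (fun μ' hμ' => ?_) hνD
      · have := hH1p μ' hμ'.1
        exact (hint μ').neg
      · rw [integral_neg, ← hI μ' (Or.inr hμ'.1) hCD (measure_mono_null
          (compl_subset_compl.2 (biUnion_subset_biUnion_left subset_union_right)) hμ'.2)]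
        exact neg_le_neg (ht μ' hμ'.1)
    rw [integral_neg] at h2
    linarith
  · intro hlt
    obtain ⟨r, hr0, hεr, hr⟩ := ENNReal.lt_iff_exists_real_btwn.1 hlt
    rw [ENNReal.ofReal_lt_ofReal_iff_of_nonneg hε.le] at hεr
    have : ∀ i : Q, IsProbabilityMeasure (i : Measure Ω) := fun i => hpre.probQ i i.2
    obtain ⟨g, hgm, hg1, hg⟩ := exists_separating_densities (q := fun i : Q => (i : Measure Ω)) hSi
      hdp hH0p hH1p (fun μ hμ => (hadapt μ (Or.inl hμ)).1) (fun μ hμ => (hadapt μ (Or.inr hμ)).1)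
      (fun μ hμ => (hadapt μ (Or.inl hμ)).2) (fun μ hμ => (hadapt μ (Or.inr hμ)).2)
      (hε.trans hεr) fun μ hμ ν hν => hr.le.trans ((iInf₂_le μ hμ).trans (iInf₂_le ν hν))
    classical
    let φ : Ω → ℝ := fun ω => if h : ∃ i : Q, ω ∈ S i then (1 + g h.choose ω) / 2 else 0
    have hφS : ∀ (i : Q), ∀ ω ∈ S i, φ ω = (1 + g i ω) / 2 := by
      intro i ω hω
      have h : ∃ i : Q, ω ∈ S i := ⟨i, hω⟩
      have hi : h.choose = i := by
        by_contra hne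
        exact disjoint_left.1 (hdp hne) h.choose_spec hω
      simp only [φ, dif_pos h, hi]
    have hφ0 : ∀ ω, (∀ i : Q, ω ∉ S i) → φ ω = 0 := fun ω hω =>
      dif_neg fun ⟨i, hi⟩ => hω i hi
    have hφm : Measurable[hahnExt Q S] φ :=
      measurable_hahnExt hSm (fun i => ((hgm i).const_add 1).div_const 2) hφS hφ0
    have hφ01 : ∀ ω, 0 ≤ φ ω ∧ φ ω ≤ 1 := by
      intro ω
      by_cases h : ∃ i : Q, ω ∈ S i
      · obtain ⟨i, hi⟩ := h
        have := abs_le.1 (hg1 i ω)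
        rw [hφS i ω hi]
        constructor <;> linarith [this.1, this.2]
      · rw [hφ0 ω fun i hi => h ⟨i, hi⟩]
        simp
    have hsum : ∀ μ ∈ H0 ∪ H1, HasSum (fun i : Q => (μ.real (S i) + ∫ ω in S i, g i ω ∂μ) / 2)
        (intOn (hahnExt Q S) (ext μ) φ) := by
      intro μ hμ
      obtain ⟨C, hC, h0⟩ := (hadapt μ hμ).1
      have := hprob μ hμ
      obtain ⟨-, -, -, hint⟩ := hbdd hφm hφ01 hC
      rw [intOn_hahnExt_eq hSm hdisj (hρ μ (Or.inl hμ)) hC h0 hφm]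
      have h := (hadapt μ hμ).1.hasSum_setIntegral hSi hdp (hint μ)
      refine h.congr_fun fun i => ?_
      have hgi : Integrable (g i) (μ.restrict (S i)) :=
        Integrable.of_bound (hgm i).aestronglyMeasurable 1 (Eventually.of_forall (hg1 i))
      have h1 : ∫ ω in S i, (⋃ i ∈ C, S i).indicator φ ω ∂μ = ∫ ω in S i, (1 + g i ω) / 2 ∂μ := by
        refine setIntegral_congr_ae (hSi i) ?_
        filter_upwards [show ∀ᵐ ω ∂μ, ω ∈ ⋃ i ∈ C, S i from h0] with ω hω hωi
        rw [indicator_of_mem hω, hφS i ω hωi]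
      rw [h1, integral_div, integral_add (integrable_const _) hgi]
      simp
    have hsep : ∀ μ ∈ H0, ∀ ν ∈ H1,
        intOn (hahnExt Q S) (ext μ) φ + r ≤ intOn (hahnExt Q S) (ext ν) φ := by
      intro μ hμ ν hν
      have := hH0p μ hμ
      have := hH1p ν hν
      obtain ⟨s, hs, hrs⟩ := hg μ hμ ν hν
      have h1 := (hsum ν (Or.inr hν)).sub (hsum μ (Or.inl hμ))
      have hmass : ∀ ρ ∈ H0 ∪ H1, HasSum (fun i : Q => ρ.real (S i)) 1 := by
        intro ρ hρ'
        have := hprob ρ hρ'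
        simpa using (hadapt ρ hρ').1.hasSum_real_inter hSi hdp MeasurableSet.univ
      have h2 := (((hmass ν (Or.inr hν)).sub (hmass μ (Or.inl hμ))).add hs).div_const 2
      have h3 := h1.unique (h2.congr_fun fun i => by ring)
      linarith
    refine ⟨φ, hφm, ⟨∅, @MeasurableSet.empty _ (hahnExt Q S), fun p hp => ?_, fun ω _ => hφ01 ω⟩, ?_⟩
    · simp [hρ p (Or.inr hp) ∅ (@MeasurableSet.empty _ (hahnExt Q S))]
    · have h1 : ∀ ν ∈ H1, sSup ((fun μ => intOn (hahnExt Q S) (ext μ) φ) '' H0) + r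
          ≤ intOn (hahnExt Q S) (ext ν) φ := fun ν hν => by
        rw [← le_sub_iff_add_le]
        refine csSup_le (hH0ne.image _) ?_
        rintro _ ⟨μ, hμ, rfl⟩
        exact le_sub_iff_add_le.2 (hsep μ hμ ν hν)
      refine lt_of_lt_of_le (add_lt_add_right hεr _) (le_csInf (hH1ne.image _) ?_)
      rintro _ ⟨ν, hν, rfl⟩
      exact h1 ν hν
end
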